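/- Let d ≥ 1, p,q ∈ (1,∞), r ∈ [p,∞), γ ∈ {0,1}, and κ := γ + d/p + 2/q − d/r; assume κ < 2 (automatically κ > 0). There is a constant N depending only on d, p, q, r, γ such that for every u on ℝ^{d+1} with u, Du, D²u, ∂_t u ∈ L_{p,q}(ℝ^{d+1}): the functions D^γ u^{(ε')}(0,·) converge in L_r(ℝ^d) as ε' ↓ 0 to a limit, denoted D^γ u(0,·), and for every ε > 0: ‖D^γ u(0,·)‖_{L_r(ℝ^d)} ≤ N·ε·(‖∂_t u‖_{L_{p,q}} + ‖D²u‖_{L_{p,q}}) + N·ε^{−κ/(2−κ)}·‖u‖_{L_{p,q}}. -/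

import Mathlib

open MeasureTheory ENNReal NNReal Metric Set Filter Topology

noncomputable section

/-- Euclidean space `ℝ^d`. -/
abbrev Spc (d : ℕ) : Type := EuclideanSpace ℝ (Fin d)

/-- Space-time `ℝ^{d+1} = ℝ × ℝ^d`, a point is `(t, x)`. -/
abbrev SpT (d : ℕ) : Type := ℝ × Spc d

/-- The parabolic cylinder `C_ρ(t₀,x₀) = [t₀, t₀+ρ²) × B_ρ(x₀)`. -/
def pCyl (d : ℕ) (ρ t₀ : ℝ) (x₀ : Spc d) : Set (SpT d) :=
  (Set.Ico t₀ (t₀ + ρ ^ 2)) ×ˢ (Metric.ball x₀ ρ)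

/-- The (unnormalized) norm `‖f‖_{L_{p,q}(A)}
    = (∫_ℝ (∫_{ℝ^d} |f(t,x)|^p 1_A(t,x) dx)^{q/p} dt)^{1/q}`. -/
def lpqNorm (d : ℕ) (p q : ℝ) (f : SpT d → ℝ) (A : Set (SpT d)) : ℝ≥0∞ :=
  (∫⁻ t : ℝ, (∫⁻ x : Spc d, A.indicator (fun z => ENNReal.ofReal |f z| ^ p) (t, x)) ^ (q / p)) ^ (1 / q)

/-- The normalized norm `⨍‖f‖_{L_{p,q}(C)}` over the cylinder `C_ρ(t₀,x₀)`:
    inner integral replaced by the average over the spatial ball, outer one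
    by the average over the time interval. -/
def avgLpq (d : ℕ) (p q ρ t₀ : ℝ) (x₀ : Spc d) (f : SpT d → ℝ) : ℝ≥0∞ :=
  ((∫⁻ t in Set.Ico t₀ (t₀ + ρ ^ 2),
      ((∫⁻ x in Metric.ball x₀ ρ, ENNReal.ofReal |f (t, x)| ^ p) / volume (Metric.ball x₀ ρ)) ^ (q / p))
      / ENNReal.ofReal (ρ ^ 2)) ^ (1 / q)

/-- The parabolic Morrey norm `‖f‖_{E_{p,q,β}}
    = sup { ρ^β ⨍‖f‖_{L_{p,q}(C)} : 0 < ρ ≤ 1, C ∈ ℂ_ρ }`. -/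
def morreyNorm (d : ℕ) (p q β : ℝ) (f : SpT d → ℝ) : ℝ≥0∞ :=
  ⨆ (ρ : ℝ) (_ : 0 < ρ) (_ : ρ ≤ 1) (t₀ : ℝ) (x₀ : Spc d),
    ENNReal.ofReal (ρ ^ β) * avgLpq d p q ρ t₀ x₀ f

/-- The homogeneous parabolic Morrey norm `‖f‖_{Ė_{p,q,β}}` (all radii `ρ > 0`). -/
def morreyNormH (d : ℕ) (p q β : ℝ) (f : SpT d → ℝ) : ℝ≥0∞ :=
  ⨆ (ρ : ℝ) (_ : 0 < ρ) (t₀ : ℝ) (x₀ : Spc d),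
    ENNReal.ofReal (ρ ^ β) * avgLpq d p q ρ t₀ x₀ f

/-- Membership `f ∈ E_{p,q,β}`. -/
def MemE (d : ℕ) (p q β : ℝ) (f : SpT d → ℝ) : Prop :=
  AEStronglyMeasurable f volume ∧ morreyNorm d p q β f ≠ ⊤

/-- Membership `f ∈ Ė_{p,q,β}` (homogeneous). -/
def MemEH (d : ℕ) (p q β : ℝ) (f : SpT d → ℝ) : Prop :=
  AEStronglyMeasurable f volume ∧ morreyNormH d p q β f ≠ ⊤

/-- The elliptic Morrey norm `‖f‖_{E_{p,β}(ℝ^d)}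
    = sup { ρ^β (⨍_{B_ρ(x)} |f|^p)^{1/p} : 0 < ρ ≤ 1, x ∈ ℝ^d }`. -/
def morreyNormE (d : ℕ) (p β : ℝ) (f : Spc d → ℝ) : ℝ≥0∞ :=
  ⨆ (ρ : ℝ) (_ : 0 < ρ) (_ : ρ ≤ 1) (x₀ : Spc d),
    ENNReal.ofReal (ρ ^ β) *
      ((∫⁻ y in Metric.ball x₀ ρ, ENNReal.ofReal |f y| ^ p) / volume (Metric.ball x₀ ρ)) ^ (1 / p)

/-- The homogeneous elliptic Morrey norm on `ℝ^d` (all radii `ρ > 0`). -/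
def morreyNormEH (d : ℕ) (p β : ℝ) (f : Spc d → ℝ) : ℝ≥0∞ :=
  ⨆ (ρ : ℝ) (_ : 0 < ρ) (x₀ : Spc d),
    ENNReal.ofReal (ρ ^ β) *
      ((∫⁻ y in Metric.ball x₀ ρ, ENNReal.ofReal |f y| ^ p) / volume (Metric.ball x₀ ρ)) ^ (1 / p)

/-- A mollifying kernel: nonnegative, smooth, compactly supported in
    `[-1,0) × B_1(0)`, with unit integral. -/
def IsMollifier (d : ℕ) (ζ : SpT d → ℝ) : Prop :=
  ContDiff ℝ (⊤ : ℕ∞) ζ ∧ (∀ z, 0 ≤ ζ z) ∧ (∫ z, ζ z) = 1 ∧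
    Function.support ζ ⊆ (Set.Ico (-1 : ℝ) 0) ×ˢ (Metric.ball (0 : Spc d) 1)

/-- The mollification `f^{(ε)} = f * ζ_ε`, where
    `ζ_ε(t,x) = ε^{-d-2} ζ(t/ε², x/ε)`. -/
def mollify (d : ℕ) (ζ : SpT d → ℝ) (ε : ℝ) (f : SpT d → ℝ) (z : SpT d) : ℝ :=
  ∫ w : SpT d, (ε ^ (-(d : ℝ) - 2) * ζ (w.1 / ε ^ 2, ε⁻¹ • w.2)) * f (z.1 - w.1, z.2 - w.2)

/-- The time direction in space-time. -/
def dirT (d : ℕ) : SpT d := (1, 0)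

/-- The `i`-th spatial direction in space-time. -/
def dirS (d : ℕ) (i : Fin d) : SpT d := (0, EuclideanSpace.single i 1)

/-- `v` is the weak derivative of `u` in the direction `e`. -/
def IsWeakDeriv (d : ℕ) (u v : SpT d → ℝ) (e : SpT d) : Prop :=
  ∀ φ : SpT d → ℝ, ContDiff ℝ (⊤ : ℕ∞) φ → HasCompactSupport φ →
    ∫ z, u z * fderiv ℝ φ z e = - ∫ z, v z * φ z

/-- `v` is the second weak derivative of `u` in the directions `e₁, e₂`. -/
def IsWeakDeriv2 (d : ℕ) (u v : SpT d → ℝ) (e₁ e₂ : SpT d) : Prop :=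
  ∀ φ : SpT d → ℝ, ContDiff ℝ (⊤ : ℕ∞) φ → HasCompactSupport φ →
    ∫ z, u z * fderiv ℝ (fun w => fderiv ℝ φ w e₁) z e₂ = ∫ z, v z * φ z

/-- The magnitude `|Du|` of the spatial gradient. -/
def gradMag (d : ℕ) (Du : Fin d → SpT d → ℝ) (z : SpT d) : ℝ :=
  Real.sqrt (∑ i, (Du i z) ^ 2)

/-- The magnitude `|D²u|` of the spatial Hessian. -/
def hessMag (d : ℕ) (D2u : Fin d → Fin d → SpT d → ℝ) (z : SpT d) : ℝ :=
  Real.sqrt (∑ i, ∑ j, (D2u i j z) ^ 2)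

/-- `u ∈ E^{1,2}_{p,q,β}`, with weak spatial gradient `Du`, weak spatial Hessian
    `D2u`, and weak time derivative `ut`, all in `E_{p,q,β}`. -/
def Mem12 (d : ℕ) (p q β : ℝ) (u : SpT d → ℝ) (Du : Fin d → SpT d → ℝ)
    (D2u : Fin d → Fin d → SpT d → ℝ) (ut : SpT d → ℝ) : Prop :=
  MemE d p q β u ∧ (∀ i, IsWeakDeriv d u (Du i) (dirS d i)) ∧
    (∀ i j, IsWeakDeriv2 d u (D2u i j) (dirS d i) (dirS d j)) ∧
    IsWeakDeriv d u ut (dirT d) ∧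
    (∀ i, MemE d p q β (Du i)) ∧ (∀ i j, MemE d p q β (D2u i j)) ∧ MemE d p q β ut

/-- `u ∈ Ė^{1,2}_{p,q,β}` (homogeneous version). -/
def Mem12H (d : ℕ) (p q β : ℝ) (u : SpT d → ℝ) (Du : Fin d → SpT d → ℝ)
    (D2u : Fin d → Fin d → SpT d → ℝ) (ut : SpT d → ℝ) : Prop :=
  MemEH d p q β u ∧ (∀ i, IsWeakDeriv d u (Du i) (dirS d i)) ∧
    (∀ i j, IsWeakDeriv2 d u (D2u i j) (dirS d i) (dirS d j)) ∧
    IsWeakDeriv d u ut (dirT d) ∧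
    (∀ i, MemEH d p q β (Du i)) ∧ (∀ i j, MemEH d p q β (D2u i j)) ∧ MemEH d p q β ut

/-- The norm `‖u‖_{E^{1,2}_{p,q,β}} = ‖u‖ + ‖Du‖ + ‖D²u‖ + ‖∂ₜu‖`. -/
def norm12 (d : ℕ) (p q β : ℝ) (u : SpT d → ℝ) (Du : Fin d → SpT d → ℝ)
    (D2u : Fin d → Fin d → SpT d → ℝ) (ut : SpT d → ℝ) : ℝ≥0∞ :=
  morreyNorm d p q β u + morreyNorm d p q β (gradMag d Du)
    + morreyNorm d p q β (hessMag d D2u) + morreyNorm d p q β ut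

/-- Membership `f ∈ L_{p,q}(ℝ^{d+1})`. -/
def MemLpq (d : ℕ) (p q : ℝ) (f : SpT d → ℝ) : Prop :=
  AEStronglyMeasurable f volume ∧ lpqNorm d p q f Set.univ ≠ ⊤

/-- `u ∈ W^{1,2}_{p,q}(ℝ^{d+1})`: `u`, its weak spatial gradient `Du`,
    weak spatial Hessian `D2u` and weak time derivative `ut` are in `L_{p,q}`. -/
def MemW12 (d : ℕ) (p q : ℝ) (u : SpT d → ℝ) (Du : Fin d → SpT d → ℝ)
    (D2u : Fin d → Fin d → SpT d → ℝ) (ut : SpT d → ℝ) : Prop :=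
  MemLpq d p q u ∧ (∀ i, IsWeakDeriv d u (Du i) (dirS d i)) ∧
    (∀ i j, IsWeakDeriv2 d u (D2u i j) (dirS d i) (dirS d j)) ∧
    IsWeakDeriv d u ut (dirT d) ∧
    (∀ i, MemLpq d p q (Du i)) ∧ (∀ i j, MemLpq d p q (D2u i j)) ∧ MemLpq d p q ut

/-- Convergence `F ε → v` in `L_r(B)` as `ε ↓ 0`. -/
def TendstoLr (d : ℕ) (r : ℝ) (B : Set (Spc d)) (F : ℝ → Spc d → ℝ) (v : Spc d → ℝ) : Prop :=
  Tendsto (fun ε => (∫⁻ x in B, ENNReal.ofReal |F ε x - v x| ^ r) ^ (1 / r))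
    (𝓝[>] (0 : ℝ)) (𝓝 0)

/-- The `L_p` seminorm of an `ℝ≥0∞`-valued function. -/
def lpE {α : Type*} [MeasurableSpace α] (μ : Measure α) (p : ℝ) (g : α → ℝ≥0∞) : ℝ≥0∞ :=
  (∫⁻ x, g x ^ p ∂μ) ^ (1 / p)

section Seminorm

variable {α β : Type*} [MeasurableSpace α] [MeasurableSpace β] {μ : Measure α} {ν : Measure β}

lemma lpE_mono_ae {p : ℝ} (hp : 0 ≤ p) {f g : α → ℝ≥0∞} (h : ∀ᵐ x ∂μ, f x ≤ g x) :
    lpE μ p f ≤ lpE μ p g := by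
  unfold lpE
  have : 0 ≤ 1 / p := by positivity
  gcongr ?_ ^ _
  exact lintegral_mono_ae (h.mono fun x hx => ENNReal.rpow_le_rpow hx hp)

lemma lpE_mono {p : ℝ} (hp : 0 ≤ p) {f g : α → ℝ≥0∞} (h : ∀ x, f x ≤ g x) :
    lpE μ p f ≤ lpE μ p g := lpE_mono_ae hp (Eventually.of_forall h)

lemma lpE_rpow {p : ℝ} (hp : 0 < p) (f : α → ℝ≥0∞) :
    lpE μ p f ^ p = ∫⁻ x, f x ^ p ∂μ := by
  unfold lpE
  rw [← ENNReal.rpow_mul, one_div_mul_cancel hp.ne', ENNReal.rpow_one]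

lemma lpE_le_of_rpow_le {p : ℝ} (hp : 0 < p) {f : α → ℝ≥0∞} {M : ℝ≥0∞}
    (h : ∫⁻ x, f x ^ p ∂μ ≤ M ^ p) : lpE μ p f ≤ M := by
  rw [← ENNReal.rpow_le_rpow_iff hp, lpE_rpow hp]
  exact h

lemma lpE_const_mul {p : ℝ} (hp : 0 < p) (c : ℝ≥0∞) {f : α → ℝ≥0∞} (hf : Measurable f) :
    lpE μ p (fun x => c * f x) = c * lpE μ p f := by
  unfold lpE
  simp_rw [ENNReal.mul_rpow_of_nonneg _ _ hp.le]
  rw [lintegral_const_mul _ (hf.pow_const p),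
    ENNReal.mul_rpow_of_nonneg _ _ (by positivity), ← ENNReal.rpow_mul,
    mul_one_div_cancel hp.ne', ENNReal.rpow_one]

lemma lpE_add_le {p : ℝ} (hp : 1 ≤ p) {f g : α → ℝ≥0∞} (hf : AEMeasurable f μ)
    (hg : AEMeasurable g μ) :
    lpE μ p (fun x => f x + g x) ≤ lpE μ p f + lpE μ p g :=
  ENNReal.lintegral_Lp_add_le hf hg hp

lemma lpE_sum_le {ι : Type*} (s : Finset ι) {p : ℝ} (hp : 1 ≤ p) {f : ι → α → ℝ≥0∞}
    (hf : ∀ i, Measurable (f i)) :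
    lpE μ p (fun x => ∑ i ∈ s, f i x) ≤ ∑ i ∈ s, lpE μ p (f i) := by
  classical
  induction s using Finset.induction_on with
  | empty =>
    have h0 : 0 < p := by linarith
    simp [lpE, h0]
  | insert a s ha ih =>
    simp only [Finset.sum_insert ha]
    exact (lpE_add_le hp (hf a).aemeasurable
      (Finset.measurable_fun_sum _ fun i _ => hf i).aemeasurable).trans (by gcongr)

lemma setLIntegral_le_lpE {p : ℝ} (hp : 1 < p) {g : α → ℝ≥0∞} (hg : Measurable g) (s : Set α) :
    ∫⁻ x in s, g x ∂μ ≤ μ s ^ (1 - 1 / p) * lpE μ p g := by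
  have hpq := Real.HolderConjugate.conjExponent hp
  have h := ENNReal.lintegral_mul_le_Lp_mul_Lq (μ.restrict s) hpq hg.aemeasurable
    (aemeasurable_const (b := (1 : ℝ≥0∞)))
  simp only [Pi.mul_apply, mul_one, ENNReal.one_rpow, lintegral_one, Measure.restrict_apply,
    MeasurableSet.univ, univ_inter] at h
  have he : 1 / Real.conjExponent p = 1 - 1 / p := by
    have := hpq.inv_add_inv_eq_one
    simp only [one_div]
    linarith
  rw [he, mul_comm] at h
  refine h.trans ?_
  unfold lpE
  have : 0 ≤ 1 / p := by positivity
  gcongr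
  exact Measure.restrict_le_self

/-- **Minkowski's integral inequality**. -/
theorem lpE_lintegral_le [SFinite μ] [SFinite ν] {p : ℝ} (hp : 1 ≤ p) {F : α → β → ℝ≥0∞}
    (hF : Measurable (Function.uncurry F)) :
    lpE μ p (fun x => ∫⁻ w, F x w ∂ν) ≤ ∫⁻ w, lpE μ p (fun x => F x w) ∂ν := by
  have hF1 : ∀ x, Measurable (F x) := fun x => hF.of_uncurry_left
  rcases hp.eq_or_lt with rfl | hp1
  · simp only [lpE, ENNReal.rpow_one, div_one]
    exact (lintegral_lintegral_swap hF.aemeasurable).le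
  have hp0 : 0 < p := by linarith
  have hpq := Real.HolderConjugate.conjExponent hp1
  have hq0 : 0 < Real.conjExponent p := hpq.symm.pos
  set q := Real.conjExponent p with hq
  set Nn : β → ℝ≥0∞ := fun w => lpE μ p (fun x => F x w) with hN
  have hFp : Measurable (Function.uncurry fun x w => F x w ^ p) := hF.pow_const p
  have hNm : Measurable Nn := (hFp.lintegral_prod_left').pow_const _
  set M := ∫⁻ w, Nn w ∂ν with hM
  rcases eq_or_ne M ⊤ with hMt | hMt
  · rw [hMt]; exact le_top
  have hfin : ∀ᵐ w ∂ν, Nn w < ⊤ := ae_lt_top hNm hMt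
  have hzero : ∀ᵐ x ∂μ, ∀ᵐ w ∂ν, (Nn w = 0 → F x w = 0) := by
    have hms : MeasurableSet {z : α × β | Nn z.2 = 0 → F z.1 z.2 = 0} := by
      have h1 : MeasurableSet {z : α × β | Nn z.2 = 0} :=
        (hNm.comp measurable_snd) (measurableSet_singleton 0)
      have h2 : MeasurableSet {z : α × β | F z.1 z.2 = 0} := hF (measurableSet_singleton 0)
      exact h1.imp h2
    rw [Measure.ae_ae_comm hms]
    refine Eventually.of_forall fun w => ?_
    by_cases hw : Nn w = 0
    · have : ∫⁻ x, F x w ^ p ∂μ = 0 := by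
        rw [← lpE_rpow hp0, show lpE μ p (fun x => F x w) = 0 from hw, ENNReal.zero_rpow_of_pos hp0]
      rw [lintegral_eq_zero_iff (hFp.of_uncurry_right)] at this
      filter_upwards [this] with x hx _
      simpa [hp0, not_lt.2 hp0.le] using hx
    · exact Eventually.of_forall fun x h => absurd h hw
  have hpt : ∀ᵐ x ∂μ, (∫⁻ w, F x w ∂ν) ^ p ≤
      (∫⁻ w, F x w ^ p * Nn w ^ (1 - p) ∂ν) * M ^ (p - 1) := by
    filter_upwards [hzero] with x hx
    have e1 : ∫⁻ w, F x w ∂ν ≤ ∫⁻ w, ((fun w => F x w * Nn w ^ (-(1 / q))) *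
        (fun w => Nn w ^ (1 / q))) w ∂ν := by
      refine lintegral_mono_ae ?_
      filter_upwards [hx, hfin] with w h0 ht
      by_cases hw : Nn w = 0
      · simp [h0 hw]
      · simp only [Pi.mul_apply]
        rw [mul_assoc, ← ENNReal.rpow_add _ _ hw ht.ne]
        simp
    have e2 := ENNReal.lintegral_mul_le_Lp_mul_Lq ν hpq
      (f := fun w => F x w * Nn w ^ (-(1 / q))) (g := fun w => Nn w ^ (1 / q))
      ((hF1 x).mul (hNm.pow_const _)).aemeasurable (hNm.pow_const _).aemeasurable
    have e3 := ENNReal.rpow_le_rpow (e1.trans e2) hp0.le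
    refine e3.trans (le_of_eq ?_)
    have hqr : p / q = p - 1 := by
      rw [hq, Real.conjExponent]; field_simp
    rw [ENNReal.mul_rpow_of_nonneg _ _ hp0.le, ← ENNReal.rpow_mul, ← ENNReal.rpow_mul,
      one_div_mul_cancel hp0.ne', ENNReal.rpow_one]
    congr 1
    · refine lintegral_congr fun w => ?_
      rw [ENNReal.mul_rpow_of_nonneg _ _ hp0.le, ← ENNReal.rpow_mul]
      congr 2
      rw [neg_mul, one_div_mul_eq_div, hqr]; ring
    · rw [one_div_mul_eq_div, hqr]
      congr 1
      refine lintegral_congr fun w => ?_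
      rw [← ENNReal.rpow_mul, one_div_mul_cancel hq0.ne', ENNReal.rpow_one]
  refine lpE_le_of_rpow_le hp0 ?_
  calc ∫⁻ x, (∫⁻ w, F x w ∂ν) ^ p ∂μ
      ≤ ∫⁻ x, (∫⁻ w, F x w ^ p * Nn w ^ (1 - p) ∂ν) * M ^ (p - 1) ∂μ := lintegral_mono_ae hpt
    _ = (∫⁻ w, ∫⁻ x, F x w ^ p * Nn w ^ (1 - p) ∂μ ∂ν) * M ^ (p - 1) := by
        have hm : Measurable (Function.uncurry fun x w => F x w ^ p * Nn w ^ (1 - p)) :=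
          hFp.mul ((hNm.comp measurable_snd).pow_const _)
        have hm' : Measurable fun x => ∫⁻ w, F x w ^ p * Nn w ^ (1 - p) ∂ν :=
          hm.lintegral_prod_right'
        rw [lintegral_mul_const _ hm', lintegral_lintegral_swap hm.aemeasurable]
    _ ≤ M * M ^ (p - 1) := by
        gcongr
        refine lintegral_mono_ae (hfin.mono fun w ht => ?_)
        rw [lintegral_mul_const _ hFp.of_uncurry_right, ← lpE_rpow hp0]
        change Nn w ^ p * Nn w ^ (1 - p) ≤ Nn w
        by_cases hw : Nn w = 0
        · simp [hw, hp0]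
        · rw [← ENNReal.rpow_add _ _ hw ht.ne]; simp
    _ = M ^ p := by
        rcases eq_or_ne M 0 with h0 | h0
        · simp [h0, hp0]
        · conv_lhs => rw [← ENNReal.rpow_one M, ← ENNReal.rpow_mul, one_mul]
          rw [← ENNReal.rpow_add _ _ h0 hMt]; congr 1; ring

end Seminorm

section Young

variable {G : Type*} [MeasurableSpace G] [AddCommGroup G] [MeasurableAdd₂ G]
  {μ : Measure G} [μ.IsAddLeftInvariant]

lemma lpE_sub_left [MeasurableNeg G] [μ.IsNegInvariant] (p : ℝ) (g : G → ℝ≥0∞) (x : G) :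
    lpE μ p (fun y => g (x - y)) = lpE μ p g := by
  unfold lpE
  rw [lintegral_sub_left_eq_self (fun y => g y ^ p)]

lemma lpE_sub_right (p : ℝ) (g : G → ℝ≥0∞) (y : G) :
    lpE μ p (fun x => g (x - y)) = lpE μ p g := by
  unfold lpE
  rw [lintegral_sub_right_eq_self (fun y => g y ^ p)]

/-- A case of Young's convolution inequality. -/
theorem lpE_setLIntegral_sub_le [MeasurableNeg G] [μ.IsNegInvariant] [SFinite μ]
    {p r : ℝ} (hp : 1 < p) (hr : p ≤ r) {g : G → ℝ≥0∞}
    (hg : Measurable g) (s : Set G) :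
    lpE μ r (fun x => ∫⁻ y in s, g (x - y) ∂μ) ≤ μ s ^ (1 - 1 / p + 1 / r) * lpE μ p g := by
  have hp0 : 0 < p := by linarith
  have hr0 : 0 < r := by linarith
  have hm : Measurable (Function.uncurry fun x y : G => g (x - y)) := hg.comp measurable_sub
  have h1 : ∀ x, ∫⁻ y in s, g (x - y) ∂μ ≤ μ s ^ (1 - 1 / p) * lpE μ p g := fun x => by
    rw [← lpE_sub_left p g x]
    exact setLIntegral_le_lpE hp (hm.of_uncurry_left) s
  have h2 : lpE μ p (fun x => ∫⁻ y in s, g (x - y) ∂μ) ≤ μ s * lpE μ p g := by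
    refine (lpE_lintegral_le hp.le hm).trans (le_of_eq ?_)
    simp_rw [lpE_sub_right]
    simp [mul_comm]
  refine lpE_le_of_rpow_le hr0 ?_
  have e0 : 0 ≤ 1 - 1 / p := by
    rw [sub_nonneg, div_le_one hp0]; exact hp.le
  have e1 : 0 ≤ 1 / r := by positivity
  have e2 : 0 ≤ r - p := by linarith
  set P := lpE μ p g
  calc ∫⁻ x, (∫⁻ y in s, g (x - y) ∂μ) ^ r ∂μ
      = ∫⁻ x, (∫⁻ y in s, g (x - y) ∂μ) ^ (r - p) * (∫⁻ y in s, g (x - y) ∂μ) ^ p ∂μ := by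
        refine lintegral_congr fun x => ?_
        rw [← ENNReal.rpow_add_of_nonneg _ _ e2 hp0.le]; congr 1; ring
    _ ≤ ∫⁻ x, (μ s ^ (1 - 1 / p) * P) ^ (r - p) * (∫⁻ y in s, g (x - y) ∂μ) ^ p ∂μ := by
        gcongr with x
        exact h1 x
    _ = (μ s ^ (1 - 1 / p) * P) ^ (r - p) * lpE μ p (fun x => ∫⁻ y in s, g (x - y) ∂μ) ^ p := by
        have hm' : Measurable fun x => ∫⁻ y in s, g (x - y) ∂μ := hm.lintegral_prod_right'
        rw [lintegral_const_mul _ (hm'.pow_const p), lpE_rpow hp0]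
    _ ≤ (μ s ^ (1 - 1 / p) * P) ^ (r - p) * (μ s * P) ^ p := by gcongr
    _ = (μ s ^ (1 - 1 / p + 1 / r) * P) ^ r := by
        rw [ENNReal.mul_rpow_of_nonneg _ _ e2, ENNReal.mul_rpow_of_nonneg _ _ hp0.le,
          ENNReal.mul_rpow_of_nonneg _ _ hr0.le, ← ENNReal.rpow_mul, ← ENNReal.rpow_mul,
          mul_mul_mul_comm, ← ENNReal.rpow_add_of_nonneg _ _ (by positivity) hp0.le,
          ← ENNReal.rpow_add_of_nonneg _ _ e2 hp0.le]
        congr 2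
        · field_simp; ring
        · ring

end Young

section MixedNorm

variable {d : ℕ} {p q r : ℝ}

lemma lpqNorm_eq_lpE (f : SpT d → ℝ) :
    lpqNorm d p q f Set.univ =
      lpE volume q (fun t : ℝ => lpE volume p (fun x : Spc d => ‖f (t, x)‖ₑ)) := by
  unfold lpqNorm lpE
  congr 1
  refine lintegral_congr fun t => ?_
  rw [← ENNReal.rpow_mul, one_div_mul_eq_div]
  simp [Real.enorm_eq_ofReal_abs]

lemma lpqNorm_mono (hp : 0 < p) (hq : 0 < q) {f g : SpT d → ℝ} (h : ∀ z, |f z| ≤ |g z|) :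
    lpqNorm d p q f Set.univ ≤ lpqNorm d p q g Set.univ := by
  rw [lpqNorm_eq_lpE, lpqNorm_eq_lpE]
  refine lpE_mono hq.le fun t => lpE_mono hp.le fun x => ?_
  simp only [Real.enorm_eq_ofReal_abs]
  exact ENNReal.ofReal_le_ofReal (h _)

lemma lpqNorm_congr_ae (hp : 0 < p) (hq : 0 < q) {f g : SpT d → ℝ} (h : f =ᵐ[volume] g) :
    lpqNorm d p q f Set.univ = lpqNorm d p q g Set.univ := by
  rw [lpqNorm_eq_lpE, lpqNorm_eq_lpE]
  have h1 : ∀ᵐ t : ℝ, ∀ᵐ x : Spc d, f (t, x) = g (t, x) := Measure.ae_ae_of_ae_prod h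
  have h2 : ∀ᵐ t : ℝ, lpE volume p (fun x : Spc d => ‖f (t, x)‖ₑ) =
      lpE volume p (fun x : Spc d => ‖g (t, x)‖ₑ) := by
    filter_upwards [h1] with t ht
    exact le_antisymm (lpE_mono_ae hp.le (ht.mono fun x hx => by rw [hx]))
      (lpE_mono_ae hp.le (ht.mono fun x hx => by rw [hx]))
  exact le_antisymm (lpE_mono_ae hq.le (h2.mono fun x hx => hx.le))
      (lpE_mono_ae hq.le (h2.mono fun x hx => hx.ge))

lemma measurable_lpE_slice {f : SpT d → ℝ} (hf : Measurable f) :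
    Measurable (fun t : ℝ => lpE volume p (fun x : Spc d => ‖f (t, x)‖ₑ)) := by
  have : Measurable (Function.uncurry fun (t : ℝ) (x : Spc d) => ‖f (t, x)‖ₑ ^ p) :=
    hf.enorm.pow_const p
  exact (this.lintegral_prod_right').pow_const _

/-- A function of finite mixed norm is locally integrable. -/
lemma MemLpq.locallyIntegrable (hp : 1 < p) (hq : 1 < q) {f : SpT d → ℝ} (hf : MemLpq d p q f) :
    LocallyIntegrable f volume := by
  have hp0 : 0 < p := by linarith
  have hq0 : 0 < q := by linarith
  obtain ⟨hfm, hfn⟩ := hf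
  rw [lpqNorm_congr_ae hp0 hq0 hfm.ae_eq_mk] at hfn
  refine LocallyIntegrable.congr ?_ hfm.ae_eq_mk.symm
  have hm : Measurable (hfm.mk f) := hfm.stronglyMeasurable_mk.measurable
  set g := hfm.mk f
  rw [MeasureTheory.locallyIntegrable_iff]
  intro K hK
  obtain ⟨R, hR⟩ := hK.isBounded.subset_closedBall 0
  refine IntegrableOn.mono_set ?_ hR
  refine ⟨hm.aestronglyMeasurable, ?_⟩
  have hset : closedBall (0 : SpT d) R = closedBall (0 : ℝ) R ×ˢ closedBall (0 : Spc d) R :=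
    (closedBall_prod_same _ _ _).symm
  have hbd : ∫⁻ z in closedBall (0 : SpT d) R, ‖g z‖ₑ ≤
      volume (closedBall (0 : ℝ) R) ^ (1 - 1 / q) *
        (volume (closedBall (0 : Spc d) R) ^ (1 - 1 / p) * lpqNorm d p q g Set.univ) := by
    rw [hset, Measure.volume_eq_prod, setLIntegral_prod _ hm.enorm.aemeasurable]
    calc ∫⁻ t in closedBall (0 : ℝ) R, ∫⁻ x in closedBall (0 : Spc d) R, ‖g (t, x)‖ₑ
        ≤ ∫⁻ t in closedBall (0 : ℝ) R, volume (closedBall (0 : Spc d) R) ^ (1 - 1 / p) *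
            lpE volume p (fun x : Spc d => ‖g (t, x)‖ₑ) := by
          gcongr with t
          exact setLIntegral_le_lpE hp (hm.enorm.comp measurable_prodMk_left) _
      _ ≤ _ := by
          refine (setLIntegral_le_lpE hq ((measurable_lpE_slice hm).const_mul _) _).trans ?_
          rw [lpE_const_mul hq0 _ (measurable_lpE_slice hm), ← lpqNorm_eq_lpE]
  refine lt_of_le_of_lt hbd ?_
  have e1 : 0 ≤ 1 - 1 / p := by rw [sub_nonneg, div_le_one hp0]; exact hp.le
  have e2 : 0 ≤ 1 - 1 / q := by rw [sub_nonneg, div_le_one hq0]; exact hq.le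
  exact ENNReal.mul_lt_top (ENNReal.rpow_lt_top_of_nonneg e2 measure_closedBall_lt_top.ne)
    (ENNReal.mul_lt_top (ENNReal.rpow_lt_top_of_nonneg e1 measure_closedBall_lt_top.ne)
      hfn.lt_top)

end MixedNorm

section Kernel

variable {d : ℕ}

instance instIsAddHaarMeasureSpT : (volume : Measure (SpT d)).IsAddHaarMeasure :=
  inferInstanceAs ((volume : Measure ℝ).prod (volume : Measure (Spc d))).IsAddHaarMeasure

/-- The parabolic dilation `η_s(t,x) = s^{-d-2} η(t/s², x/s)`. -/
def dil (η : SpT d → ℝ) (s : ℝ) (w : SpT d) : ℝ :=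
  s ^ (-(d : ℝ) - 2) * η (w.1 / s ^ 2, s⁻¹ • w.2)

lemma mollify_eq (η : SpT d → ℝ) (s : ℝ) (f : SpT d → ℝ) (z : SpT d) :
    mollify d η s f z = ∫ w, dil η s w * f (z - w) := rfl

lemma mollify_eq_swap (η : SpT d → ℝ) (s : ℝ) (f : SpT d → ℝ) (z : SpT d) :
    mollify d η s f z = ∫ w, dil η s (z - w) * f w := by
  rw [mollify_eq, ← integral_sub_left_eq_self _ volume z]
  simp

lemma mollify_congr_ae (η : SpT d → ℝ) (s : ℝ) {f g : SpT d → ℝ} (h : f =ᵐ[volume] g) :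
    mollify d η s f = mollify d η s g := by
  ext z
  rw [mollify_eq_swap, mollify_eq_swap]
  exact integral_congr_ae (h.mono fun w hw => by simp only [hw])

/-- Smooth compactly supported kernels. -/
def IsTest (η : SpT d → ℝ) : Prop := ContDiff ℝ (⊤ : ℕ∞) η ∧ HasCompactSupport η

lemma IsTest.exists_bound {η : SpT d → ℝ} (hη : IsTest η) :
    ∃ R M : ℝ, 1 ≤ R ∧ 0 ≤ M ∧ (∀ w, ‖η w‖ ≤ M) ∧
      ∀ w, η w ≠ 0 → w.1 ∈ Icc (-R) R ∧ w.2 ∈ closedBall (0 : Spc d) R := by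
  obtain ⟨M, hM⟩ := hη.2.exists_bound_of_continuous hη.1.continuous
  obtain ⟨R, hR⟩ := hη.2.isCompact.isBounded.subset_closedBall 0
  refine ⟨max R 1, M, le_max_right _ _, (norm_nonneg _).trans (hM 0), hM, fun w hw => ?_⟩
  have h := hR (subset_tsupport η hw)
  rw [mem_closedBall_zero_iff, Prod.norm_def, max_le_iff] at h
  constructor
  · rw [mem_Icc, ← abs_le]; exact h.1.trans (le_max_left _ _)
  · rw [mem_closedBall_zero_iff]; exact h.2.trans (le_max_left _ _)

lemma dil_support {η : SpT d → ℝ} {R s : ℝ} (hs : 0 < s)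
    (hR : ∀ w, η w ≠ 0 → w.1 ∈ Icc (-R) R ∧ w.2 ∈ closedBall (0 : Spc d) R) (w : SpT d)
    (hw : dil η s w ≠ 0) :
    w.1 ∈ Icc (-(s ^ 2 * R)) (s ^ 2 * R) ∧ w.2 ∈ closedBall (0 : Spc d) (s * R) := by
  have h := hR _ (right_ne_zero_of_mul hw)
  constructor
  · have h1 := h.1
    rw [mem_Icc, ← abs_le] at h1 ⊢
    dsimp only at h1
    rw [abs_div, abs_of_pos (by positivity : 0 < s ^ 2), div_le_iff₀ (by positivity)] at h1
    linarith
  · have h2 := h.2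
    rw [mem_closedBall_zero_iff] at h2 ⊢
    dsimp only at h2
    rw [norm_smul, norm_inv, Real.norm_of_nonneg hs.le, inv_mul_le_iff₀ hs] at h2
    exact h2

lemma enorm_dil_le {η : SpT d → ℝ} {R M s : ℝ} (hs : 0 < s) (hM : ∀ w, ‖η w‖ ≤ M)
    (hR : ∀ w, η w ≠ 0 → w.1 ∈ Icc (-R) R ∧ w.2 ∈ closedBall (0 : Spc d) R) (w : SpT d) :
    ‖dil η s w‖ₑ ≤ (Icc (-(s ^ 2 * R)) (s ^ 2 * R) ×ˢ closedBall (0 : Spc d) (s * R)).indicator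
      (fun _ => ENNReal.ofReal (s ^ (-(d : ℝ) - 2)) * ENNReal.ofReal M) w := by
  by_cases hw : dil η s w = 0
  · simp [hw]
  · rw [indicator_of_mem (show w ∈ _ from dil_support hs hR w hw), dil, enorm_mul]
    gcongr
    · rw [Real.enorm_of_nonneg (by positivity)]
    · rw [← ofReal_norm]
      exact ENNReal.ofReal_le_ofReal (hM _)

lemma enorm_mollify_le {η : SpT d → ℝ} {R M s : ℝ} (hs : 0 < s) (hM : ∀ w, ‖η w‖ ≤ M)
    (hR : ∀ w, η w ≠ 0 → w.1 ∈ Icc (-R) R ∧ w.2 ∈ closedBall (0 : Spc d) R)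
    {f : SpT d → ℝ} (hf : Measurable f) (t : ℝ) (x : Spc d) :
    ‖mollify d η s f (t, x)‖ₑ ≤ ENNReal.ofReal (s ^ (-(d : ℝ) - 2)) * ENNReal.ofReal M *
      ∫⁻ τ in Icc (-(s ^ 2 * R)) (s ^ 2 * R),
        ∫⁻ y in closedBall (0 : Spc d) (s * R), ‖f (t - τ, x - y)‖ₑ := by
  set c := ENNReal.ofReal (s ^ (-(d : ℝ) - 2)) * ENNReal.ofReal M
  have hfm : Measurable fun w : SpT d => ‖f ((t, x) - w)‖ₑ :=
    (hf.comp (measurable_const.sub measurable_id)).enorm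
  calc ‖mollify d η s f (t, x)‖ₑ
      ≤ ∫⁻ w, ‖dil η s w * f ((t, x) - w)‖ₑ := enorm_integral_le_lintegral_enorm _
    _ ≤ ∫⁻ w, (Icc (-(s ^ 2 * R)) (s ^ 2 * R) ×ˢ closedBall (0 : Spc d) (s * R)).indicator
          (fun w => c * ‖f ((t, x) - w)‖ₑ) w := by
        refine lintegral_mono fun w => ?_
        rw [enorm_mul]
        refine (mul_le_mul_left (enorm_dil_le hs hM hR w) _).trans (le_of_eq ?_)
        by_cases hw : w ∈ Icc (-(s ^ 2 * R)) (s ^ 2 * R) ×ˢ closedBall (0 : Spc d) (s * R)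
        · simp only [indicator_of_mem hw]; rfl
        · simp only [indicator_of_notMem hw, zero_mul]
    _ = _ := by
        rw [lintegral_indicator (measurableSet_Icc.prod measurableSet_closedBall),
          lintegral_const_mul _ hfm, Measure.volume_eq_prod,
          setLIntegral_prod _ hfm.aemeasurable]
        rfl

/-- The trace at a fixed time of a mollified function, in terms of the scale. -/
theorem IsTest.lpE_mollify_le {p q r : ℝ} (hp : 1 < p) (hq : 1 < q) (hr : p ≤ r)
    {η : SpT d → ℝ} (hη : IsTest η) :
    ∃ C : ℝ≥0∞, C ≠ ⊤ ∧ ∀ f : SpT d → ℝ, AEStronglyMeasurable f volume → ∀ (t s : ℝ), 0 < s →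
      lpE volume r (fun x : Spc d => ‖mollify d η s f (t, x)‖ₑ) ≤
        C * ENNReal.ofReal (s ^ (-((d : ℝ) / p + 2 / q - d / r))) *
          lpqNorm d p q f Set.univ := by
  obtain ⟨R, M, hR1, hM0, hM, hR⟩ := hη.exists_bound
  have hp0 : 0 < p := by linarith
  have hq0 : 0 < q := by linarith
  have hr0 : 0 < r := by linarith
  have hr1 : 1 ≤ r := by linarith
  have e1 : 0 ≤ 1 - 1 / p + 1 / r := by
    have : 1 / p ≤ 1 := by rw [div_le_one hp0]; exact hp.le
    have : 0 < 1 / r := by positivity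
    linarith
  have e2 : 0 ≤ 1 - 1 / q := by rw [sub_nonneg, div_le_one hq0]; exact hq.le
  set V := volume (closedBall (0 : Spc d) R) with hV
  refine ⟨ENNReal.ofReal M * V ^ (1 - 1 / p + 1 / r) * ENNReal.ofReal (2 * R) ^ (1 - 1 / q),
    ?_, fun f hf t s hs => ?_⟩
  · exact ENNReal.mul_ne_top (ENNReal.mul_ne_top ENNReal.ofReal_ne_top
      (ENNReal.rpow_ne_top_of_nonneg e1 measure_closedBall_lt_top.ne))
      (ENNReal.rpow_ne_top_of_nonneg e2 ENNReal.ofReal_ne_top)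
  rw [mollify_congr_ae η s hf.ae_eq_mk, lpqNorm_congr_ae hp0 hq0 hf.ae_eq_mk]
  have hg : Measurable (hf.mk f) := hf.stronglyMeasurable_mk.measurable
  set g := hf.mk f
  set I := Icc (-(s ^ 2 * R)) (s ^ 2 * R)
  set B := closedBall (0 : Spc d) (s * R)
  set c := ENNReal.ofReal (s ^ (-(d : ℝ) - 2)) * ENNReal.ofReal M with hc
  have hGm : Measurable fun z : (Spc d × ℝ) × Spc d => ‖g (t - z.1.2, z.1.1 - z.2)‖ₑ := by
    fun_prop
  have hHm : Measurable (Function.uncurry fun (x : Spc d) (τ : ℝ) =>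
      ∫⁻ y in B, ‖g (t - τ, x - y)‖ₑ) := hGm.lintegral_prod_right'
  have hvB : volume B = ENNReal.ofReal (s ^ d) * V := by
    have := Measure.addHaar_closedBall_mul (volume : Measure (Spc d)) 0 hs.le
      (zero_le_one.trans hR1)
    simpa using this
  have hvI : volume I = ENNReal.ofReal (s ^ 2) * ENNReal.ofReal (2 * R) := by
    rw [Real.volume_Icc, ← ENNReal.ofReal_mul (by positivity)]
    congr 1; ring
  have step : lpE volume r (fun x : Spc d => ∫⁻ τ in I, ∫⁻ y in B, ‖g (t - τ, x - y)‖ₑ) ≤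
      volume I ^ (1 - 1 / q) * (volume B ^ (1 - 1 / p + 1 / r) * lpqNorm d p q g Set.univ) := by
    calc lpE volume r (fun x : Spc d => ∫⁻ τ in I, ∫⁻ y in B, ‖g (t - τ, x - y)‖ₑ)
        ≤ ∫⁻ τ in I, lpE volume r (fun x : Spc d => ∫⁻ y in B, ‖g (t - τ, x - y)‖ₑ) :=
          lpE_lintegral_le hr1 hHm
      _ ≤ ∫⁻ τ in I, volume B ^ (1 - 1 / p + 1 / r) *
            lpE volume p (fun x : Spc d => ‖g (t - τ, x)‖ₑ) := by
          gcongr with τ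
          exact lpE_setLIntegral_sub_le hp hr (g := fun x => ‖g (t - τ, x)‖ₑ)
            (hg.enorm.comp measurable_prodMk_left) B
      _ ≤ _ := by
          have hm1 : Measurable fun τ : ℝ => lpE volume p (fun x : Spc d => ‖g (t - τ, x)‖ₑ) :=
            (measurable_lpE_slice (p := p) hg).comp (measurable_const.sub measurable_id)
          refine (setLIntegral_le_lpE hq (hm1.const_mul _) _).trans ?_
          rw [lpE_const_mul hq0 _ hm1, lpqNorm_eq_lpE]
          rw [lpE_sub_left q (fun t => lpE volume p (fun x : Spc d => ‖g (t, x)‖ₑ)) t]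
  have hHm' : Measurable fun x : Spc d => ∫⁻ τ in I, ∫⁻ y in B, ‖g (t - τ, x - y)‖ₑ :=
    hHm.lintegral_prod_right'
  calc lpE volume r (fun x : Spc d => ‖mollify d η s g (t, x)‖ₑ)
      ≤ lpE volume r (fun x : Spc d => c * ∫⁻ τ in I, ∫⁻ y in B, ‖g (t - τ, x - y)‖ₑ) :=
        lpE_mono hr0.le fun x => enorm_mollify_le hs hM hR hg t x
    _ ≤ c * (volume I ^ (1 - 1 / q) *
          (volume B ^ (1 - 1 / p + 1 / r) * lpqNorm d p q g Set.univ)) := by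
        rw [lpE_const_mul hr0 _ hHm']
        gcongr
    _ = _ := by
        have hsc : ENNReal.ofReal (s ^ (-(d : ℝ) - 2)) * (ENNReal.ofReal (s ^ 2) ^ (1 - 1 / q) *
            ENNReal.ofReal (s ^ d) ^ (1 - 1 / p + 1 / r)) =
            ENNReal.ofReal (s ^ (-((d : ℝ) / p + 2 / q - d / r))) := by
          rw [ENNReal.ofReal_rpow_of_nonneg (by positivity) e2,
            ENNReal.ofReal_rpow_of_nonneg (by positivity) e1,
            ← ENNReal.ofReal_mul (by positivity), ← ENNReal.ofReal_mul (by positivity),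
            ← Real.rpow_natCast s d, ← Real.rpow_natCast s 2, ← Real.rpow_mul hs.le,
            ← Real.rpow_mul hs.le, ← Real.rpow_add hs, ← Real.rpow_add hs]
          congr 2
          push_cast
          ring
        rw [hvB, hvI, ENNReal.mul_rpow_of_nonneg _ _ e1, ENNReal.mul_rpow_of_nonneg _ _ e2, hc,
          ← hsc]
        ring

end Kernel

section TestFunctions

variable {d : ℕ} {η : SpT d → ℝ}

lemma IsTest.fderiv_apply (hη : IsTest η) (e : SpT d) : IsTest (fun w => fderiv ℝ η w e) :=
  ⟨(hη.1.fderiv_right (by simp)).clm_apply contDiff_const, hη.2.fderiv_apply ℝ e⟩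

lemma IsTest.mul_left (hη : IsTest η) {g : SpT d → ℝ} (hg : ContDiff ℝ (⊤ : ℕ∞) g) :
    IsTest (fun w => g w * η w) :=
  ⟨hg.mul hη.1, hη.2.mul_left⟩

lemma IsTest.dil (hη : IsTest η) {s : ℝ} (hs : 0 < s) : IsTest (dil η s) := by
  refine ⟨?_, ?_⟩
  · refine contDiff_const.mul (hη.1.comp ?_)
    fun_prop
  · obtain ⟨R, M, -, -, -, hR⟩ := hη.exists_bound
    refine HasCompactSupport.of_support_subset_isCompact
      (K := Icc (-(s ^ 2 * R)) (s ^ 2 * R) ×ˢ closedBall (0 : Spc d) (s * R))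
      (isCompact_Icc.prod (isCompact_closedBall _ _)) fun w hw => dil_support hs hR w hw

lemma hasFDerivAt_dil (hη : IsTest η) (s : ℝ) (w : SpT d) {e : SpT d} {c : ℝ}
    (hc : (e.1 / s ^ 2, s⁻¹ • e.2) = c • e) :
    fderiv ℝ (_root_.dil η s) w e = c * _root_.dil (fun w => fderiv ℝ η w e) s w := by
  set A : SpT d →L[ℝ] SpT d :=
    ((s ^ 2)⁻¹ • ContinuousLinearMap.fst ℝ ℝ (Spc d)).prod
      (s⁻¹ • ContinuousLinearMap.snd ℝ ℝ (Spc d)) with hA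
  have hAw : ∀ w, A w = (w.1 / s ^ 2, s⁻¹ • w.2) := fun w => by
    simp [hA, div_eq_inv_mul]
  have h1 : HasFDerivAt η (fderiv ℝ η (A w)) (A w) :=
    (hη.1.differentiable (by simp) _).hasFDerivAt
  have h2 : HasFDerivAt (_root_.dil η s) (s ^ (-(d : ℝ) - 2) • (fderiv ℝ η (A w)).comp A) w := by
    have := (h1.comp w A.hasFDerivAt).const_mul (s ^ (-(d : ℝ) - 2))
    refine this.congr_of_eventuallyEq (Eventually.of_forall fun y => ?_)
    simp [_root_.dil, hAw]
  rw [h2.fderiv]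
  simp only [FunLike.coe_smul, ContinuousLinearMap.comp_apply, Pi.smul_apply, smul_eq_mul,
    _root_.dil]
  rw [hAw e, hc, map_smul, hAw w, smul_eq_mul]
  ring

/-- The generator of the parabolic dilations: `∂_s η_s = s⁻¹ (gen η)_s`. -/
def gen (η : SpT d → ℝ) (w : SpT d) : ℝ :=
  -(((d : ℝ) + 2) * η w + fderiv ℝ η w (2 * w.1, w.2))

lemma IsTest.gen (hη : IsTest η) : IsTest (gen η) := by
  refine ⟨?_, ?_⟩
  · refine ((contDiff_const.mul hη.1).add
      ((hη.1.fderiv_right (m := (⊤ : ℕ∞)) (by simp)).clm_apply ?_)).neg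
    fun_prop
  · refine HasCompactSupport.intro hη.2 fun w hw => ?_
    have h1 : fderiv ℝ η w = 0 :=
      image_eq_zero_of_notMem_tsupport fun h => hw (tsupport_fderiv_subset ℝ h)
    simp [_root_.gen, h1, image_eq_zero_of_notMem_tsupport hw]

lemma hasDerivAt_dil (hη : IsTest η) {s : ℝ} (hs : 0 < s) (w : SpT d) :
    HasDerivAt (fun σ => dil η σ w) (s⁻¹ * dil (gen η) s w) s := by
  have h1 : HasDerivAt (fun σ : ℝ => w.1 / σ ^ 2) (-s⁻¹ * (2 * (w.1 / s ^ 2))) s := by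
    have := ((hasDerivAt_pow 2 s).inv (by positivity)).const_mul w.1
    refine (this.congr_of_eventuallyEq ?_).congr_deriv ?_
    · exact Eventually.of_forall fun σ => by simp [div_eq_mul_inv]
    · simp; field_simp
  have h2 : HasDerivAt (fun σ : ℝ => σ⁻¹ • w.2) (-s⁻¹ • (s⁻¹ • w.2)) s := by
    refine ((hasDerivAt_inv hs.ne').smul_const w.2).congr_deriv ?_
    rw [smul_smul]; congr 1; field_simp
  have h3 := h1.prodMk h2
  have h4 : HasDerivAt (fun σ : ℝ => η (w.1 / σ ^ 2, σ⁻¹ • w.2))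
      (fderiv ℝ η (w.1 / s ^ 2, s⁻¹ • w.2)
        (-s⁻¹ * (2 * (w.1 / s ^ 2)), -s⁻¹ • (s⁻¹ • w.2))) s :=
    (hη.1.differentiable (by simp) _).hasFDerivAt.comp_hasDerivAt s h3
  have h5 := (Real.hasDerivAt_rpow_const (p := -(d : ℝ) - 2) (Or.inl hs.ne')).mul h4
  refine h5.congr_deriv ?_
  have h6 : ((-s⁻¹ * (2 * (w.1 / s ^ 2)), -s⁻¹ • (s⁻¹ • w.2)) : SpT d) =
      (-s⁻¹) • ((2 * (w.1 / s ^ 2), s⁻¹ • w.2) : SpT d) := rfl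
  rw [h6, map_smul, smul_eq_mul, dil, gen, Real.rpow_sub_one hs.ne']
  dsimp only
  field_simp
  ring

end TestFunctions

section Mollification

variable {d : ℕ} {η f : SpT d → ℝ}

lemma integrable_dil_mul (hη : IsTest η) (hf : LocallyIntegrable f volume) {s : ℝ} (hs : 0 < s)
    (z : SpT d) : Integrable (fun w => dil η s (z - w) * f w) volume := by
  have h1 : Continuous fun w => dil η s (z - w) :=
    (hη.dil hs).1.continuous.comp (continuous_const.sub continuous_id)
  have h2 : HasCompactSupport fun w => dil η s (z - w) :=
    (hη.dil hs).2.comp_homeomorph (Homeomorph.subLeft z)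
  exact hf.integrable_smul_left_of_hasCompactSupport h1 h2

lemma hasDerivAt_mollify (hη : IsTest η) (hf : LocallyIntegrable f volume) {s : ℝ} (hs : 0 < s)
    (z : SpT d) :
    HasDerivAt (fun σ => mollify d η σ f z) (s⁻¹ * mollify d (gen η) s f z) s := by
  obtain ⟨R, M, hR1, hM0, hM, hR⟩ := hη.gen.exists_bound
  have hnhd : Ioo (s / 2) (2 * s) ∈ 𝓝 s := Ioo_mem_nhds (by linarith) (by linarith)
  set K := closedBall z (((2 * s) ^ 2 + 2 * s) * R) with hK
  set c := (s / 2)⁻¹ * ((s / 2) ^ (-(d : ℝ) - 2) * M)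
  have hbint : Integrable (fun w => K.indicator (fun w => c * ‖f w‖) w) volume := by
    rw [integrable_indicator_iff measurableSet_closedBall]
    exact ((hf.integrableOn_isCompact (isCompact_closedBall _ _)).norm).const_mul _
  have key := hasDerivAt_integral_of_dominated_loc_of_deriv_le (μ := volume)
    (F := fun σ w => dil η σ (z - w) * f w)
    (F' := fun σ w => σ⁻¹ * dil (gen η) σ (z - w) * f w) (x₀ := s)
    (bound := fun w => K.indicator (fun w => c * ‖f w‖) w) hnhd ?_ ?_ ?_ ?_ hbint ?_
  · have h2 := key.2
    simp_rw [mollify_eq_swap]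
    refine h2.congr_deriv ?_
    rw [← integral_const_mul]
    simp_rw [mul_assoc]
  · filter_upwards [hnhd] with σ hσ
    exact (integrable_dil_mul hη hf (by linarith [hσ.1]) z).aestronglyMeasurable
  · exact integrable_dil_mul hη hf hs z
  · have := (integrable_dil_mul hη.gen hf hs z).const_mul s⁻¹
    simp_rw [← mul_assoc] at this
    exact this.aestronglyMeasurable
  · refine Eventually.of_forall fun w σ hσ => ?_
    have hσ0 : 0 < σ := by linarith [hσ.1]
    by_cases hw : dil (gen η) σ (z - w) = 0
    · simp only [hw, mul_zero, zero_mul, norm_zero]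
      exact indicator_nonneg (fun w _ => by positivity) w
    · have h1 := dil_support hσ0 hR _ hw
      have hwK : w ∈ K := by
        have ha : ‖(z - w).1‖ ≤ σ ^ 2 * R := by
          rw [Real.norm_eq_abs]; exact abs_le.2 h1.1
        have hb : ‖(z - w).2‖ ≤ σ * R := by simpa using h1.2
        have hR0 : 0 ≤ R := by linarith
        have hσ2 : σ ≤ 2 * s := hσ.2.le
        rw [hK, mem_closedBall', dist_eq_norm, Prod.norm_def, max_le_iff]
        have : σ ^ 2 * R ≤ (2 * s) ^ 2 * R := by gcongr
        have : σ * R ≤ (2 * s) * R := by gcongr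
        have : 0 ≤ (2 * s) ^ 2 * R := by positivity
        have : 0 ≤ (2 * s) * R := by positivity
        constructor <;> nlinarith
      rw [indicator_of_mem hwK, norm_mul]
      refine mul_le_mul_of_nonneg_right ?_ (norm_nonneg _)
      rw [norm_mul, dil, norm_mul, Real.norm_of_nonneg (by positivity),
        Real.norm_of_nonneg (by positivity)]
      have hσ1 : s / 2 ≤ σ := hσ.1.le
      have hle : σ ^ (-(d : ℝ) - 2) ≤ (s / 2) ^ (-(d : ℝ) - 2) :=
        Real.rpow_le_rpow_of_nonpos (by positivity) hσ1 (by
          have : (0 : ℝ) ≤ d := by positivity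
          linarith)
      change _ ≤ (s / 2)⁻¹ * ((s / 2) ^ (-(d : ℝ) - 2) * M)
      gcongr
      exact hM _
  · refine Eventually.of_forall fun w σ hσ => ?_
    have hσ0 : 0 < σ := by linarith [hσ.1]
    exact (hasDerivAt_dil hη hσ0 (z - w)).mul_const (f w)

lemma mollify_sub_mollify (hη : IsTest η) (hf : LocallyIntegrable f volume) {s S : ℝ}
    (hs : 0 < s) (hsS : s ≤ S) (z : SpT d) :
    mollify d η S f z - mollify d η s f z =
      ∫ σ in Ioc s S, σ⁻¹ * mollify d (gen η) σ f z := by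
  rw [← intervalIntegral.integral_of_le hsS]
  refine (intervalIntegral.integral_eq_sub_of_hasDerivAt
    (f := fun σ => mollify d η σ f z) (fun σ hσ => ?_) ?_).symm
  · rw [uIcc_of_le hsS] at hσ
    exact hasDerivAt_mollify hη hf (hs.trans_le hσ.1) z
  · refine ContinuousOn.intervalIntegrable fun σ hσ => ?_
    rw [uIcc_of_le hsS] at hσ
    have h0 : 0 < σ := hs.trans_le hσ.1
    exact ((continuousAt_inv₀ h0.ne').mul
      (hasDerivAt_mollify hη.gen hf h0 z).continuousAt).continuousWithinAt

lemma measurable_mollify (hη : IsTest η) (hf : AEStronglyMeasurable f volume) :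
    Measurable (fun a : ℝ × SpT d => mollify d η a.1 f a.2) := by
  simp_rw [fun s : ℝ => mollify_congr_ae η s hf.ae_eq_mk]
  have hg : Measurable (hf.mk f) := hf.stronglyMeasurable_mk.measurable
  set g := hf.mk f
  have hηm : Measurable η := hη.1.continuous.measurable
  have : Measurable (fun b : (ℝ × SpT d) × SpT d => dil η b.1.1 b.2 * g (b.1.2 - b.2)) := by
    unfold dil
    fun_prop
  exact (this.stronglyMeasurable.integral_prod_right' (ν := volume)).measurable

lemma convolution_eq_mollify (η : SpT d → ℝ) (s : ℝ) (f : SpT d → ℝ) :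
    convolution (dil η s) f (ContinuousLinearMap.mul ℝ ℝ) volume = mollify d η s f := rfl

lemma fderiv_mollify_apply (hη : IsTest η) (hf : LocallyIntegrable f volume) {s : ℝ} (hs : 0 < s)
    (z : SpT d) {e : SpT d} {c : ℝ} (hc : (e.1 / s ^ 2, s⁻¹ • e.2) = c • e) :
    fderiv ℝ (mollify d η s f) z e = c * mollify d (fun w => fderiv ℝ η w e) s f z := by
  have hd := hη.dil hs
  have h := hd.2.hasFDerivAt_convolution_left (ContinuousLinearMap.mul ℝ ℝ)
    (hd.1.of_le (by simp)) hf z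
  rw [convolution_eq_mollify] at h
  have hd' : Continuous (fderiv ℝ (dil η s)) := hd.1.continuous_fderiv (by simp)
  have hi := ((hd.2.fderiv ℝ).convolutionExists_left
    ((ContinuousLinearMap.mul ℝ ℝ).precompL (SpT d)) hd' hf z).integrable
  rw [h.fderiv, convolution_def, ContinuousLinearMap.integral_apply hi, mollify_eq,
    ← integral_const_mul]
  refine integral_congr_ae (Eventually.of_forall fun w => ?_)
  simp only [ContinuousLinearMap.precompL_apply, ContinuousLinearMap.mul_apply']
  rw [hasFDerivAt_dil hη s w hc, mul_assoc]

lemma IsWeakDeriv.mollify_eq {v : SpT d → ℝ} {e : SpT d} (hw : IsWeakDeriv d f v e)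
    (hη : IsTest η) {s : ℝ} (hs : 0 < s) {c : ℝ} (hc : (e.1 / s ^ 2, s⁻¹ • e.2) = c • e)
    (z : SpT d) :
    c * mollify d (fun w => fderiv ℝ η w e) s f z = mollify d η s v z := by
  have hd := hη.dil hs
  have h := hw (fun w => dil η s (z - w)) (hd.1.comp (contDiff_const.sub contDiff_id))
    (hd.2.comp_homeomorph (Homeomorph.subLeft z))
  have hder : ∀ w, fderiv ℝ (fun w => dil η s (z - w)) w e =
      -(c * dil (fun w => fderiv ℝ η w e) s (z - w)) := fun w => by
    have h1 : HasFDerivAt (dil η s) (fderiv ℝ (dil η s) (z - w)) (z - w) :=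
      (hd.1.differentiable (by simp) _).hasFDerivAt
    have h2 := h1.comp w ((hasFDerivAt_id w).const_sub z)
    rw [show (fun w => dil η s (z - w)) = dil η s ∘ HSub.hSub z from rfl, h2.fderiv]
    simp only [ContinuousLinearMap.comp_apply, neg_apply,
      ContinuousLinearMap.id_apply, map_neg]
    rw [hasFDerivAt_dil hη s _ hc]
  simp_rw [hder] at h
  rw [mollify_eq_swap, mollify_eq_swap, ← integral_const_mul]
  have e1 : ∫ w, f w * -(c * dil (fun w => fderiv ℝ η w e) s (z - w)) =
      -∫ w, c * (dil (fun w => fderiv ℝ η w e) s (z - w) * f w) := by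
    rw [← integral_neg]; congr 1; ext w; ring
  rw [e1, neg_inj] at h
  rw [h]
  congr 1; ext w; ring

lemma dirS_scale (d : ℕ) (i : Fin d) (s : ℝ) :
    ((dirS d i).1 / s ^ 2, s⁻¹ • (dirS d i).2) = s⁻¹ • dirS d i := by
  ext <;> simp [dirS]

lemma dirT_scale (d : ℕ) (s : ℝ) :
    ((dirT d).1 / s ^ 2, s⁻¹ • (dirT d).2) = (s ^ 2)⁻¹ • dirT d := by
  ext <;> simp [dirT]

lemma contDiff_coord {d : ℕ} (i : Fin d) : ContDiff ℝ (⊤ : ℕ∞) (fun w : SpT d => w.2 i) := by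
  fun_prop

/-- The generator is in divergence form. -/
lemma gen_eq (hη : IsTest η) (w : SpT d) :
    gen η w = -(fderiv ℝ (fun w => (2 * w.1) * η w) w (dirT d) +
      ∑ i, fderiv ℝ (fun w => w.2 i * η w) w (dirS d i)) := by
  have hd : DifferentiableAt ℝ η w := hη.1.differentiable (by simp) _
  have h1 : fderiv ℝ (fun w : SpT d => (2 * w.1) * η w) w (dirT d) =
      2 * η w + 2 * w.1 * fderiv ℝ η w (dirT d) := by
    have h : HasFDerivAt (fun w : SpT d => 2 * w.1)
        ((2 : ℝ) • ContinuousLinearMap.fst ℝ ℝ (Spc d)) w :=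
      ((2 : ℝ) • ContinuousLinearMap.fst ℝ ℝ (Spc d)).hasFDerivAt
    rw [(h.fun_mul hd.hasFDerivAt).fderiv]
    simp [dirT]; ring
  have h2 : ∀ i, fderiv ℝ (fun w : SpT d => w.2 i * η w) w (dirS d i) =
      η w + w.2 i * fderiv ℝ η w (dirS d i) := fun i => by
    have h : HasFDerivAt (fun w : SpT d => w.2 i)
        ((EuclideanSpace.proj i).comp (ContinuousLinearMap.snd ℝ ℝ (Spc d))) w :=
      ((EuclideanSpace.proj i).comp (ContinuousLinearMap.snd ℝ ℝ (Spc d))).hasFDerivAt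
    rw [(h.fun_mul hd.hasFDerivAt).fderiv]
    simp [dirS]; ring
  have h3 : ((2 * w.1, w.2) : SpT d) = (2 * w.1) • dirT d + ∑ i, w.2 i • dirS d i := by
    ext j
    · simp [dirT, dirS, Prod.fst_sum]
    · simp [dirT, dirS, Prod.snd_sum, Pi.single_apply]
  rw [gen, h3, map_add, map_smul, map_sum, h1, Finset.sum_congr rfl fun i _ => h2 i,
    Finset.sum_add_distrib]
  simp only [map_smul, smul_eq_mul, Finset.sum_const, Finset.card_univ, Fintype.card_fin,
    nsmul_eq_mul]
  ring

lemma mollify_gen (hη : IsTest η) (hf : LocallyIntegrable f volume) {s : ℝ} (hs : 0 < s)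
    (z : SpT d) :
    mollify d (gen η) s f z =
      -(mollify d (fun w => fderiv ℝ (fun w => (2 * w.1) * η w) w (dirT d)) s f z +
        ∑ i, mollify d (fun w => fderiv ℝ (fun w => w.2 i * η w) w (dirS d i)) s f z) := by
  have hT : IsTest (fun w => fderiv ℝ (fun w : SpT d => (2 * w.1) * η w) w (dirT d)) :=
    (hη.mul_left (by fun_prop)).fderiv_apply _
  have hS : ∀ i, IsTest (fun w => fderiv ℝ (fun w : SpT d => w.2 i * η w) w (dirS d i)) :=
    fun i => (hη.mul_left (contDiff_coord i)).fderiv_apply _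
  simp_rw [mollify_eq_swap]
  rw [← integral_finsetSum _ fun i _ => integrable_dil_mul (hS i) hf hs z,
    ← integral_add (integrable_dil_mul hT hf hs z)
      (integrable_finsetSum _ fun i _ => integrable_dil_mul (hS i) hf hs z), ← integral_neg]
  congr 1
  ext w
  simp only [dil, gen_eq hη]
  rw [← Finset.sum_mul, ← Finset.mul_sum]
  ring

end Mollification

lemma lintegral_Ioc_rpow {b S : ℝ} (hb : b < 1) (hS : 0 < S) :
    ∫⁻ σ in Ioc 0 S, ENNReal.ofReal (σ ^ (-b)) = ENNReal.ofReal (S ^ (1 - b) / (1 - b)) := by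
  have hi : IntervalIntegrable (fun σ : ℝ => σ ^ (-b)) volume 0 S :=
    intervalIntegral.intervalIntegrable_rpow' (by linarith)
  rw [← ofReal_integral_eq_lintegral_ofReal
    ((intervalIntegrable_iff_integrableOn_Ioc_of_le hS.le).1 hi),
    ← intervalIntegral.integral_of_le hS.le, integral_rpow (Or.inl (by linarith)),
    Real.zero_rpow (by linarith)]
  · congr 2
    · rw [sub_zero]; congr 1; ring
    · ring
  · refine (ae_restrict_mem measurableSet_Ioc).mono fun σ hσ => ?_
    exact Real.rpow_nonneg hσ.1.le _

section ScaleFlow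

variable {d : ℕ} {η f : SpT d → ℝ} {r : ℝ}

lemma measurable_mollify_slice (hη : IsTest η) (hf : AEStronglyMeasurable f volume) (s t : ℝ) :
    Measurable fun x : Spc d => mollify d η s f (t, x) :=
  (measurable_mollify hη hf).comp (measurable_const.prodMk (measurable_const.prodMk measurable_id))

lemma measurable_scale_deriv (hη : IsTest η) (hf : AEStronglyMeasurable f volume) (t : ℝ) :
    Measurable (Function.uncurry fun (x : Spc d) (σ : ℝ) =>
      σ⁻¹ * mollify d (gen η) σ f (t, x)) :=
  measurable_snd.inv.mul ((measurable_mollify hη.gen hf).comp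
    (measurable_snd.prodMk (measurable_const.prodMk measurable_fst)))

lemma lpE_setLIntegral_scale_le (hr : 1 ≤ r) (hη : IsTest η) (hf : LocallyIntegrable f volume)
    (t : ℝ) {h : ℝ → ℝ≥0∞} {s : Set ℝ} (hs : MeasurableSet s)
    (hh : ∀ σ ∈ s,
      lpE volume r (fun x : Spc d => ‖σ⁻¹ * mollify d (gen η) σ f (t, x)‖ₑ) ≤ h σ) :
    lpE volume r (fun x : Spc d => ∫⁻ σ in s, ‖σ⁻¹ * mollify d (gen η) σ f (t, x)‖ₑ) ≤
      ∫⁻ σ in s, h σ :=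
  (lpE_lintegral_le hr (measurable_scale_deriv hη hf.aestronglyMeasurable t).enorm).trans
    (setLIntegral_mono' hs hh)

lemma lpE_mollify_le_add (hr : 1 ≤ r) (hη : IsTest η) (hf : LocallyIntegrable f volume) (t : ℝ)
    {h : ℝ → ℝ≥0∞} {s S : ℝ} (hs : 0 < s) (hsS : s ≤ S)
    (hh : ∀ σ ∈ Ioc s S,
      lpE volume r (fun x : Spc d => ‖σ⁻¹ * mollify d (gen η) σ f (t, x)‖ₑ) ≤ h σ) :
    lpE volume r (fun x : Spc d => ‖mollify d η s f (t, x)‖ₑ) ≤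
      lpE volume r (fun x : Spc d => ‖mollify d η S f (t, x)‖ₑ) + ∫⁻ σ in Ioc s S, h σ := by
  have hm := measurable_scale_deriv hη hf.aestronglyMeasurable t
  have hm' : Measurable fun x : Spc d =>
      ∫⁻ σ in Ioc s S, ‖σ⁻¹ * mollify d (gen η) σ f (t, x)‖ₑ := hm.enorm.lintegral_prod_right'
  calc lpE volume r (fun x : Spc d => ‖mollify d η s f (t, x)‖ₑ)
      ≤ lpE volume r (fun x : Spc d => ‖mollify d η S f (t, x)‖ₑ +
          ∫⁻ σ in Ioc s S, ‖σ⁻¹ * mollify d (gen η) σ f (t, x)‖ₑ) := by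
        refine lpE_mono (by linarith) fun x => ?_
        have e : mollify d η s f (t, x) = mollify d η S f (t, x) -
            ∫ σ in Ioc s S, σ⁻¹ * mollify d (gen η) σ f (t, x) := by
          rw [← mollify_sub_mollify hη hf hs hsS]; ring
        rw [e]
        refine enorm_sub_le.trans ?_
        gcongr
        exact enorm_integral_le_lintegral_enorm _
    _ ≤ _ := (lpE_add_le hr
        (measurable_mollify_slice hη hf.aestronglyMeasurable S t).enorm.aemeasurable
        hm'.aemeasurable).trans
          (by gcongr; exact lpE_setLIntegral_scale_le hr hη hf t measurableSet_Ioc hh)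

lemma exists_trace (hr : 1 ≤ r) (hη : IsTest η) (hf : LocallyIntegrable f volume) (t : ℝ)
    {h : ℝ → ℝ≥0∞} {S : ℝ} (hS : 0 < S)
    (hh : ∀ σ ∈ Ioc 0 S,
      lpE volume r (fun x : Spc d => ‖σ⁻¹ * mollify d (gen η) σ f (t, x)‖ₑ) ≤ h σ)
    (hfin : ∫⁻ σ in Ioc 0 S, h σ ≠ ⊤) :
    ∃ v : Spc d → ℝ, Measurable v ∧
      Tendsto (fun s => lpE volume r (fun x : Spc d => ‖mollify d η s f (t, x) - v x‖ₑ))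
        (𝓝[>] 0) (𝓝 0) := by
  have hr0 : 0 < r := by linarith
  have hm := measurable_scale_deriv hη hf.aestronglyMeasurable t
  have hm' : Measurable fun x : Spc d =>
      ∫⁻ σ in Ioc 0 S, ‖σ⁻¹ * mollify d (gen η) σ f (t, x)‖ₑ := hm.enorm.lintegral_prod_right'
  have hi : ∀ᵐ x : Spc d,
      IntegrableOn (fun σ => σ⁻¹ * mollify d (gen η) σ f (t, x)) (Ioc 0 S) volume := by
    have h1 := (lpE_setLIntegral_scale_le hr hη hf t measurableSet_Ioc hh).trans_lt hfin.lt_top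
    have h2 : ∫⁻ x : Spc d,
        (∫⁻ σ in Ioc 0 S, ‖σ⁻¹ * mollify d (gen η) σ f (t, x)‖ₑ) ^ r < ⊤ := by
      rw [← lpE_rpow hr0]; exact ENNReal.rpow_lt_top_of_nonneg hr0.le h1.ne
    filter_upwards [ae_lt_top (hm'.pow_const r) h2.ne] with x hx
    refine ⟨(hm.of_uncurry_left (x := x)).aestronglyMeasurable, ?_⟩
    exact (ENNReal.rpow_lt_top_iff_of_pos hr0).1 hx
  refine ⟨fun x => mollify d η S f (t, x) - ∫ σ in Ioc 0 S, σ⁻¹ * mollify d (gen η) σ f (t, x),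
    (measurable_mollify_slice hη hf.aestronglyMeasurable S t).sub
      (hm.stronglyMeasurable.integral_prod_right' (ν := volume.restrict (Ioc 0 S))).measurable, ?_⟩
  have hlim : Tendsto (fun s : ℝ => ∫⁻ σ in Ioc 0 s, h σ ∂(volume.restrict (Ioc 0 S)))
      (𝓝[>] 0) (𝓝 0) := by
    refine tendsto_setLIntegral_zero hfin ?_
    have h1 : Tendsto (fun s : ℝ => ENNReal.ofReal (s - 0)) (𝓝[>] 0) (𝓝 0) := by
      have : Tendsto (fun s : ℝ => ENNReal.ofReal (s - 0)) (𝓝 0) (𝓝 (ENNReal.ofReal (0 - 0))) :=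
        (ENNReal.continuous_ofReal.comp (continuous_id.sub continuous_const)).tendsto 0
      simp only [sub_zero, ENNReal.ofReal_zero] at this ⊢
      exact this.mono_left nhdsWithin_le_nhds
    refine tendsto_of_tendsto_of_tendsto_of_le_of_le tendsto_const_nhds h1
      (fun _ => zero_le) fun s => ?_
    rw [← Real.volume_Ioc]
    exact Measure.restrict_le_self _
  refine tendsto_of_tendsto_of_tendsto_of_le_of_le' tendsto_const_nhds hlim
    (Eventually.of_forall fun _ => zero_le) ?_
  filter_upwards [Ioc_mem_nhdsGT hS] with s hs
  have hsub : Ioc 0 s ⊆ Ioc 0 S := Ioc_subset_Ioc_right hs.2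
  rw [Measure.restrict_restrict_of_subset hsub]
  refine le_trans ?_ (lpE_setLIntegral_scale_le hr hη hf t measurableSet_Ioc
    fun σ hσ => hh σ (hsub hσ))
  refine lpE_mono_ae hr0.le (hi.mono fun x hx => ?_)
  have e1 := mollify_sub_mollify hη hf hs.1 hs.2 (t, x)
  have e2 : ∫ σ in Ioc 0 S, σ⁻¹ * mollify d (gen η) σ f (t, x) =
      (∫ σ in Ioc 0 s, σ⁻¹ * mollify d (gen η) σ f (t, x)) +
        ∫ σ in Ioc s S, σ⁻¹ * mollify d (gen η) σ f (t, x) := by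
    rw [← Ioc_union_Ioc_eq_Ioc hs.1.le hs.2]
    exact setIntegral_union (Ioc_disjoint_Ioc_of_le le_rfl) measurableSet_Ioc
      (hx.mono_set hsub) (hx.mono_set (Ioc_subset_Ioc_left hs.1.le))
  have e3 : mollify d η s f (t, x) - (mollify d η S f (t, x) -
      ∫ σ in Ioc 0 S, σ⁻¹ * mollify d (gen η) σ f (t, x)) =
      ∫ σ in Ioc 0 s, σ⁻¹ * mollify d (gen η) σ f (t, x) := by
    rw [e2, ← e1]; ring
  rw [e3]
  exact enorm_integral_le_lintegral_enorm _

end ScaleFlow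

section Sobolev

variable {d : ℕ} {p q r a : ℝ} {θ u ut : SpT d → ℝ} {Du : Fin d → SpT d → ℝ}
  {D2u : Fin d → Fin d → SpT d → ℝ}

lemma IsWeakDeriv2.isWeakDeriv {u v w : SpT d → ℝ} {e₁ e₂ : SpT d}
    (h₂ : IsWeakDeriv2 d u w e₁ e₂) (h₁ : IsWeakDeriv d u v e₂) : IsWeakDeriv d v w e₁ := by
  intro φ hφ hφc
  have hφ' := IsTest.fderiv_apply ⟨hφ, hφc⟩ e₁
  have := h₁ _ hφ'.1 hφ'.2
  rw [h₂ φ hφ hφc] at this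
  rw [this, neg_neg]

lemma IsTest.fderiv_fderiv_comm (hθ : IsTest θ) (e e' : SpT d) :
    (fun w => fderiv ℝ (fun w => fderiv ℝ θ w e) w e') =
      fun w => fderiv ℝ (fun w => fderiv ℝ θ w e') w e := by
  have hd : Differentiable ℝ (fderiv ℝ θ) :=
    (hθ.1.fderiv_right (m := (⊤ : ℕ∞)) (by simp)).differentiable (by simp)
  ext w
  have h (e e' : SpT d) : fderiv ℝ (fun w => fderiv ℝ θ w e) w e' =
      fderiv ℝ (fderiv ℝ θ) w e' e := by
    rw [fderiv_clm_apply (hd w) (differentiableAt_const e)]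
    simp
  rw [h, h]
  refine (hθ.1.contDiffAt.isSymmSndFDerivAt ?_).eq _ _
  rw [minSmoothness_of_isRCLikeNormedField]
  exact WithTop.coe_le_coe.2 (le_top : (2 : ℕ∞) ≤ ⊤)

lemma abs_le_hessMag (D2u : Fin d → Fin d → SpT d → ℝ) (i j : Fin d) (z : SpT d) :
    |D2u i j z| ≤ |hessMag d D2u z| := by
  rw [hessMag, abs_of_nonneg (Real.sqrt_nonneg _)]
  refine Real.abs_le_sqrt ?_
  calc D2u i j z ^ 2 ≤ ∑ j, D2u i j z ^ 2 :=
        Finset.single_le_sum (f := fun j => D2u i j z ^ 2) (fun _ _ => sq_nonneg _)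
          (Finset.mem_univ j)
    _ ≤ _ := Finset.single_le_sum (f := fun i => ∑ j, D2u i j z ^ 2)
        (fun _ _ => Finset.sum_nonneg fun _ _ => sq_nonneg _) (Finset.mem_univ i)

lemma inv_mul_mollify_gen_deriv (hp : 1 < p) (hq : 1 < q) (hW : MemW12 d p q u Du D2u ut)
    (hθ : IsTest θ) (i : Fin d) {σ : ℝ} (hσ : 0 < σ) (z : SpT d) :
    σ⁻¹ * mollify d (gen θ) σ (Du i) z =
      -(mollify d (fun w => fderiv ℝ (fun w => (2 * w.1) * θ w) w (dirS d i)) σ ut z +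
        ∑ j, mollify d (fun w => w.2 j * θ w) σ (D2u j i) z) := by
  obtain ⟨hu, hDu, hD2u, hut, hmD, -, -⟩ := hW
  have hκ : IsTest (fun w : SpT d => (2 * w.1) * θ w) := hθ.mul_left (by fun_prop)
  have hκj : ∀ j, IsTest (fun w : SpT d => w.2 j * θ w) := fun j => hθ.mul_left (contDiff_coord j)
  have h1 : σ⁻¹ * mollify d (fun w => fderiv ℝ (fun w => (2 * w.1) * θ w) w (dirT d)) σ (Du i) z =
      mollify d (fun w => fderiv ℝ (fun w => (2 * w.1) * θ w) w (dirS d i)) σ ut z := by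
    rw [← (hDu i).mollify_eq (hκ.fderiv_apply _) hσ (dirS_scale d i σ), hκ.fderiv_fderiv_comm,
      ← hut.mollify_eq (hκ.fderiv_apply _) hσ (dirT_scale d σ)]
    ring
  have h2 : ∀ j,
      σ⁻¹ * mollify d (fun w => fderiv ℝ (fun w => w.2 j * θ w) w (dirS d j)) σ (Du i) z =
      mollify d (fun w => w.2 j * θ w) σ (D2u j i) z := fun j =>
    ((hD2u j i).isWeakDeriv (hDu i)).mollify_eq (hκj j) hσ (dirS_scale d j σ) z
  rw [mollify_gen hθ ((hmD i).locallyIntegrable hp hq) hσ, mul_neg, mul_add, Finset.mul_sum, h1]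
  simp_rw [h2]

lemma inv_mul_mollify_gen (hp : 1 < p) (hq : 1 < q) (hW : MemW12 d p q u Du D2u ut)
    (hθ : IsTest θ) {σ : ℝ} (hσ : 0 < σ) (z : SpT d) :
    σ⁻¹ * mollify d (gen θ) σ u z =
      -(σ * mollify d (fun w => (2 * w.1) * θ w) σ ut z +
        ∑ j, mollify d (fun w => w.2 j * θ w) σ (Du j) z) := by
  obtain ⟨hu, hDu, hD2u, hut, hmD, -, -⟩ := hW
  have hκ : IsTest (fun w : SpT d => (2 * w.1) * θ w) := hθ.mul_left (by fun_prop)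
  have hκj : ∀ j, IsTest (fun w : SpT d => w.2 j * θ w) := fun j => hθ.mul_left (contDiff_coord j)
  have h1 : σ⁻¹ * mollify d (fun w => fderiv ℝ (fun w => (2 * w.1) * θ w) w (dirT d)) σ u z =
      σ * mollify d (fun w => (2 * w.1) * θ w) σ ut z := by
    rw [← hut.mollify_eq hκ hσ (dirT_scale d σ)]
    field_simp
  have h2 : ∀ j, σ⁻¹ * mollify d (fun w => fderiv ℝ (fun w => w.2 j * θ w) w (dirS d j)) σ u z =
      mollify d (fun w => w.2 j * θ w) σ (Du j) z := fun j =>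
    (hDu j).mollify_eq (hκj j) hσ (dirS_scale d j σ) z
  rw [mollify_gen hθ (hu.locallyIntegrable hp hq) hσ, mul_neg, mul_add, Finset.mul_sum, h1]
  simp_rw [h2]

lemma lpE_neg_add_sum_le {ι α : Type*} [Fintype ι] [MeasurableSpace α] {μ : Measure α}
    (hr : 1 ≤ r) {X : α → ℝ} {Y : ι → α → ℝ} (hX : Measurable X) (hY : ∀ i, Measurable (Y i)) :
    lpE μ r (fun x => ‖-(X x + ∑ i, Y i x)‖ₑ) ≤
      lpE μ r (fun x => ‖X x‖ₑ) + ∑ i, lpE μ r (fun x => ‖Y i x‖ₑ) := by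
  calc lpE μ r (fun x => ‖-(X x + ∑ i, Y i x)‖ₑ)
      ≤ lpE μ r (fun x => ‖X x‖ₑ + ∑ i, ‖Y i x‖ₑ) := by
        refine lpE_mono (by linarith) fun x => ?_
        rw [enorm_neg]
        exact (enorm_add_le _ _).trans (by gcongr; exact enorm_sum_le _ _)
    _ ≤ _ := (lpE_add_le hr hX.enorm.aemeasurable
        (Finset.measurable_sum _ fun i _ => (hY i).enorm).aemeasurable).trans
        (by gcongr; exact lpE_sum_le _ hr fun i => (hY i).enorm)

/-- The sum of the `L_{p,q}` norms of the time derivative and the Hessian. -/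
def topNorm (d : ℕ) (p q : ℝ) (ut : SpT d → ℝ) (D2u : Fin d → Fin d → SpT d → ℝ) : ℝ≥0∞ :=
  lpqNorm d p q ut Set.univ + lpqNorm d p q (hessMag d D2u) Set.univ

lemma exists_lpE_gen_deriv_le (hp : 1 < p) (hq : 1 < q) (hpr : p ≤ r)
    (ha : a = (d : ℝ) / p + 2 / q - d / r) (hθ : IsTest θ) :
    ∃ C : ℝ≥0∞, C ≠ ⊤ ∧ ∀ (u : SpT d → ℝ) (Du : Fin d → SpT d → ℝ)
      (D2u : Fin d → Fin d → SpT d → ℝ) (ut : SpT d → ℝ), MemW12 d p q u Du D2u ut →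
      ∀ (i : Fin d) (t σ : ℝ), 0 < σ →
        lpE volume r (fun x : Spc d => ‖σ⁻¹ * mollify d (gen θ) σ (Du i) (t, x)‖ₑ) ≤
          C * ENNReal.ofReal (σ ^ (-a)) * topNorm d p q ut D2u := by
  have hκ : ∀ i, IsTest (fun w : SpT d => fderiv ℝ (fun w => (2 * w.1) * θ w) w (dirS d i)) :=
    fun i => (hθ.mul_left (by fun_prop)).fderiv_apply _
  have hκj : ∀ j, IsTest (fun w : SpT d => w.2 j * θ w) := fun j => hθ.mul_left (contDiff_coord j)
  choose C hC hCle using fun i => (hκ i).lpE_mollify_le hp hq hpr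
  choose C' hC' hCle' using fun j => (hκj j).lpE_mollify_le hp hq hpr
  rw [← ha] at hCle hCle'
  refine ⟨∑ i, C i + ∑ j, C' j,
    ENNReal.add_ne_top.2 ⟨ENNReal.sum_ne_top.2 fun i _ => hC i,
      ENNReal.sum_ne_top.2 fun i _ => hC' i⟩,
    fun u Du D2u ut hW i t σ hσ => ?_⟩
  simp_rw [inv_mul_mollify_gen_deriv hp hq hW hθ i hσ]
  obtain ⟨-, -, -, -, -, hmD2, hmut⟩ := hW
  refine (lpE_neg_add_sum_le (by linarith) (measurable_mollify_slice (hκ i) hmut.1 σ t)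
    fun j => measurable_mollify_slice (hκj j) (hmD2 j i).1 σ t).trans ?_
  rw [add_mul, add_mul, Finset.sum_mul, Finset.sum_mul, Finset.sum_mul, Finset.sum_mul]
  refine add_le_add ?_ (Finset.sum_le_sum fun j _ => ?_)
  · refine (hCle i _ hmut.1 t σ hσ).trans ?_
    refine le_trans ?_ (Finset.single_le_sum (f := fun i => C i * ENNReal.ofReal (σ ^ (-a)) *
      topNorm d p q ut D2u) (fun _ _ => zero_le) (Finset.mem_univ i))
    gcongr
    exact le_self_add
  · refine (hCle' j _ (hmD2 j i).1 t σ hσ).trans ?_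
    gcongr
    exact (lpqNorm_mono (by linarith) (by linarith) (abs_le_hessMag D2u j i)).trans le_add_self

lemma lintegral_Ioc_rpow_neg_le {b s S : ℝ} (hb : 0 ≤ b) (hab : a - b < 1) (hs : 0 < s)
    (hsS : s ≤ S) :
    ∫⁻ σ in Ioc s S, ENNReal.ofReal (σ ^ (-a)) ≤
      ENNReal.ofReal (s ^ (-b) * (S ^ (1 + b - a) / (1 + b - a))) := by
  have hS : 0 < S := hs.trans_le hsS
  calc ∫⁻ σ in Ioc s S, ENNReal.ofReal (σ ^ (-a))
      ≤ ∫⁻ σ in Ioc s S, ENNReal.ofReal (s ^ (-b)) * ENNReal.ofReal (σ ^ (-(a - b))) := by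
        refine setLIntegral_mono' measurableSet_Ioc fun σ hσ => ?_
        have h0 : 0 < σ := hs.trans hσ.1
        rw [← ENNReal.ofReal_mul (by positivity)]
        refine ENNReal.ofReal_le_ofReal ?_
        rw [show -a = -b + -(a - b) by ring, Real.rpow_add h0]
        gcongr ?_ * _
        exact Real.rpow_le_rpow_of_nonpos hs hσ.1.le (by linarith)
    _ = ENNReal.ofReal (s ^ (-b)) * ∫⁻ σ in Ioc s S, ENNReal.ofReal (σ ^ (-(a - b))) :=
        lintegral_const_mul _ (by fun_prop)
    _ ≤ ENNReal.ofReal (s ^ (-b)) * ∫⁻ σ in Ioc 0 S, ENNReal.ofReal (σ ^ (-(a - b))) := by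
        gcongr
    _ = _ := by
        rw [lintegral_Ioc_rpow hab hS, ← ENNReal.ofReal_mul (by positivity),
          show 1 - (a - b) = 1 + b - a by ring]

lemma exists_lpE_deriv_le (hp : 1 < p) (hq : 1 < q) (hpr : p ≤ r)
    (ha : a = (d : ℝ) / p + 2 / q - d / r) {b : ℝ} (hb : 0 ≤ b) (hab : a - b < 1)
    (hθ : IsTest θ) :
    ∃ C : ℝ≥0∞, C ≠ ⊤ ∧ ∀ (u : SpT d → ℝ) (Du : Fin d → SpT d → ℝ)
      (D2u : Fin d → Fin d → SpT d → ℝ) (ut : SpT d → ℝ), MemW12 d p q u Du D2u ut →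
      ∀ (i : Fin d) (t s S : ℝ), 0 < s → s ≤ S →
        lpE volume r (fun x : Spc d => ‖mollify d θ s (Du i) (t, x)‖ₑ) ≤
          C * (ENNReal.ofReal (s ^ (-b) * S ^ (1 + b - a)) * topNorm d p q ut D2u +
            ENNReal.ofReal (S ^ (-(1 + a))) * lpqNorm d p q u Set.univ) := by
  obtain ⟨C, hC, hCle⟩ := exists_lpE_gen_deriv_le hp hq hpr ha hθ
  choose C' hC' hCle' using fun i => (hθ.fderiv_apply (dirS d i)).lpE_mollify_le hp hq hpr
  rw [← ha] at hCle'
  set k := ENNReal.ofReal ((1 + b - a)⁻¹)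
  refine ⟨C * k + ∑ j, C' j, ENNReal.add_ne_top.2 ⟨ENNReal.mul_ne_top hC ENNReal.ofReal_ne_top,
    ENNReal.sum_ne_top.2 fun i _ => hC' i⟩, fun u Du D2u ut hW i t s S hs hsS => ?_⟩
  have hS : 0 < S := hs.trans_le hsS
  refine (lpE_mollify_le_add (by linarith) hθ ((hW.2.2.2.2.1 i).locallyIntegrable hp hq) t hs hsS
    fun σ hσ => hCle u Du D2u ut hW i t σ (hs.trans hσ.1)).trans ?_
  rw [mul_add, add_comm]
  refine add_le_add ?_ ?_
  · rw [lintegral_mul_const _ (by fun_prop), lintegral_const_mul _ (by fun_prop), ← mul_assoc]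
    gcongr ?_ * _
    calc C * ∫⁻ σ in Ioc s S, ENNReal.ofReal (σ ^ (-a))
        ≤ C * (k * ENNReal.ofReal (s ^ (-b) * S ^ (1 + b - a))) := by
          gcongr
          refine (lintegral_Ioc_rpow_neg_le hb hab hs hsS).trans_eq ?_
          rw [← ENNReal.ofReal_mul (by rw [inv_nonneg]; linarith)]
          congr 1; ring
      _ ≤ _ := by rw [← mul_assoc]; gcongr; exact le_self_add
  · simp_rw [← (hW.2.1 i).mollify_eq hθ hS (dirS_scale d i S), enorm_mul]
    rw [lpE_const_mul (by linarith) _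
      (measurable_mollify_slice (hθ.fderiv_apply _) hW.1.1 S t).enorm]
    calc ‖S⁻¹‖ₑ * lpE volume r (fun x : Spc d =>
          ‖mollify d (fun w => fderiv ℝ θ w (dirS d i)) S u (t, x)‖ₑ)
        ≤ ‖S⁻¹‖ₑ * (C' i * ENNReal.ofReal (S ^ (-a)) * lpqNorm d p q u Set.univ) := by
          gcongr; exact hCle' i u hW.1.1 t S hS
      _ = C' i * (ENNReal.ofReal (S ^ (-(1 + a))) * lpqNorm d p q u Set.univ) := by
          rw [neg_add, Real.rpow_add hS, ENNReal.ofReal_mul (by positivity), Real.rpow_neg_one,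
            Real.enorm_eq_ofReal (by positivity)]
          ring
      _ ≤ _ := by
          gcongr
          exact (Finset.single_le_sum (f := C') (fun _ _ => zero_le) (Finset.mem_univ i)).trans
            le_add_self

end Sobolev

section TraceBound

variable {d : ℕ} {p q r a : ℝ} {θ : SpT d → ℝ}

lemma lpqNorm_sum_abs_le {ι : Type*} [Fintype ι] (hp : 1 ≤ p) (hq : 1 ≤ q) {f : ι → SpT d → ℝ}
    (hf : ∀ i, AEStronglyMeasurable (f i) volume) :
    lpqNorm d p q (fun z => ∑ i, |f i z|) Set.univ ≤ ∑ i, lpqNorm d p q (f i) Set.univ := by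
  have hp0 : 0 < p := by linarith
  have hq0 : 0 < q := by linarith
  set g := fun i => (hf i).mk (f i)
  have hg : ∀ i, Measurable (g i) := fun i => (hf i).stronglyMeasurable_mk.measurable
  have hfg : (fun z => ∑ i, |f i z|) =ᵐ[volume] fun z => ∑ i, |g i z| := by
    filter_upwards [ae_all_iff.2 fun i => (hf i).ae_eq_mk] with z hz
    exact Finset.sum_congr rfl fun i _ => by rw [hz i]
  rw [lpqNorm_congr_ae hp0 hq0 hfg]
  simp_rw [fun i => lpqNorm_congr_ae hp0 hq0 (hf i).ae_eq_mk, lpqNorm_eq_lpE]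
  calc _ ≤ lpE volume q (fun t : ℝ => ∑ i, lpE volume p (fun x : Spc d => ‖g i (t, x)‖ₑ)) := by
        refine lpE_mono hq0.le fun t => ?_
        refine le_trans (lpE_mono hp0.le fun x => ?_) (lpE_sum_le Finset.univ hp fun i =>
          ((hg i).comp measurable_prodMk_left).enorm)
        refine (enorm_sum_le _ _).trans_eq (Finset.sum_congr rfl fun i _ => ?_)
        simp [Real.enorm_eq_ofReal_abs]
    _ ≤ _ := lpE_sum_le _ hq fun i => measurable_lpE_slice (hg i)

lemma abs_hessMag_le (D2u : Fin d → Fin d → SpT d → ℝ) (z : SpT d) :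
    |hessMag d D2u z| ≤ |∑ ij : Fin d × Fin d, (|D2u ij.1 ij.2 z|)| := by
  have h0 : 0 ≤ ∑ ij : Fin d × Fin d, |D2u ij.1 ij.2 z| :=
    Finset.sum_nonneg fun _ _ => abs_nonneg _
  rw [hessMag, abs_of_nonneg (Real.sqrt_nonneg _), abs_of_nonneg h0, ← Fintype.sum_prod_type']
  refine Real.sqrt_le_iff.2 ⟨h0, ?_⟩
  simpa using Finset.sum_sq_le_sq_sum_of_nonneg (s := Finset.univ)
    (f := fun ij : Fin d × Fin d => |D2u ij.1 ij.2 z|) fun _ _ => abs_nonneg _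

variable {u ut : SpT d → ℝ} {Du : Fin d → SpT d → ℝ} {D2u : Fin d → Fin d → SpT d → ℝ}

lemma MemW12.topNorm_ne_top (hp : 1 ≤ p) (hq : 1 ≤ q) (hW : MemW12 d p q u Du D2u ut) :
    topNorm d p q ut D2u ≠ ⊤ := by
  obtain ⟨-, -, -, -, -, hmD2, hmut⟩ := hW
  refine ENNReal.add_ne_top.2 ⟨hmut.2, ne_top_of_le_ne_top ?_
    ((lpqNorm_mono (by linarith) (by linarith) (abs_hessMag_le D2u)).trans
      (lpqNorm_sum_abs_le hp hq (f := fun ij : Fin d × Fin d => D2u ij.1 ij.2)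
        fun ij => (hmD2 ij.1 ij.2).1))⟩
  exact ENNReal.sum_ne_top.2 fun ij _ => (hmD2 ij.1 ij.2).2

/-- The right-hand side of the trace estimate at scale `S`. -/
def traceBound (d : ℕ) (p q κ S : ℝ) (u ut : SpT d → ℝ) (D2u : Fin d → Fin d → SpT d → ℝ) :
    ℝ≥0∞ :=
  ENNReal.ofReal (S ^ (2 - κ)) * topNorm d p q ut D2u +
    ENNReal.ofReal (S ^ (-κ)) * lpqNorm d p q u Set.univ

lemma exists_lpE_gen_le (hp : 1 < p) (hq : 1 < q) (hpr : p ≤ r)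
    (ha : a = (d : ℝ) / p + 2 / q - d / r) (ha0 : 0 ≤ a) (ha2 : a < 2) (hθ : IsTest θ) :
    ∃ C : ℝ≥0∞, C ≠ ⊤ ∧ ∀ (u : SpT d → ℝ) (Du : Fin d → SpT d → ℝ)
      (D2u : Fin d → Fin d → SpT d → ℝ) (ut : SpT d → ℝ), MemW12 d p q u Du D2u ut →
      ∀ (t σ S : ℝ), 0 < σ → σ ≤ S →
        lpE volume r (fun x : Spc d => ‖σ⁻¹ * mollify d (gen θ) σ u (t, x)‖ₑ) ≤
          C * ENNReal.ofReal (σ ^ (-(a / 2))) * traceBound d p q (1 + a / 2) S u ut D2u := by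
  have hκ : IsTest (fun w : SpT d => (2 * w.1) * θ w) := hθ.mul_left (by fun_prop)
  have hκj : ∀ j, IsTest (fun w : SpT d => w.2 j * θ w) := fun j => hθ.mul_left (contDiff_coord j)
  obtain ⟨C, hC, hCle⟩ := hκ.lpE_mollify_le hp hq hpr
  choose C' hC' hCle' using fun j => exists_lpE_deriv_le (a := a) (b := a / 2) hp hq hpr ha
    (by linarith) (by linarith) (hκj j)
  rw [← ha] at hCle
  refine ⟨C + ∑ j, C' j, ENNReal.add_ne_top.2 ⟨hC, ENNReal.sum_ne_top.2 fun i _ => hC' i⟩,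
    fun u Du D2u ut hW t σ S hσ hσS => ?_⟩
  have hS : 0 < S := hσ.trans_le hσS
  have hmD := hW.2.2.2.2.1
  have hmut := hW.2.2.2.2.2.2
  simp_rw [inv_mul_mollify_gen hp hq hW hθ hσ]
  have hm := measurable_mollify_slice hκ hmut.1 σ t
  refine (lpE_neg_add_sum_le (by linarith) (hm.const_mul σ)
    fun j => measurable_mollify_slice (hκj j) (hmD j).1 σ t).trans ?_
  rw [add_mul, add_mul, Finset.sum_mul, Finset.sum_mul]
  have hpow : ENNReal.ofReal (σ ^ (1 - a)) ≤
      ENNReal.ofReal (σ ^ (-(a / 2))) * ENNReal.ofReal (S ^ (2 - (1 + a / 2))) := by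
    rw [← ENNReal.ofReal_mul (by positivity)]
    refine ENNReal.ofReal_le_ofReal ?_
    rw [show 1 - a = -(a / 2) + (2 - (1 + a / 2)) by ring, Real.rpow_add hσ]
    gcongr
    linarith
  refine add_le_add ?_ (Finset.sum_le_sum fun j _ => ?_)
  · simp_rw [enorm_mul]
    rw [lpE_const_mul (by linarith) _ hm.enorm]
    calc ‖σ‖ₑ * lpE volume r (fun x : Spc d =>
          ‖mollify d (fun w => (2 * w.1) * θ w) σ ut (t, x)‖ₑ)
        ≤ ‖σ‖ₑ * (C * ENNReal.ofReal (σ ^ (-a)) * lpqNorm d p q ut Set.univ) := by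
          gcongr; exact hCle ut hmut.1 t σ hσ
      _ = C * (ENNReal.ofReal (σ ^ (1 - a)) * lpqNorm d p q ut Set.univ) := by
          rw [sub_eq_add_neg, Real.rpow_add hσ, ENNReal.ofReal_mul (by positivity), Real.rpow_one,
            Real.enorm_eq_ofReal hσ.le]
          ring
      _ ≤ C * (ENNReal.ofReal (σ ^ (-(a / 2))) * ENNReal.ofReal (S ^ (2 - (1 + a / 2))) *
            topNorm d p q ut D2u) := by
          gcongr
          exact le_self_add
      _ ≤ _ := by
          rw [mul_assoc, mul_assoc, traceBound]
          gcongr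
          exact le_self_add
  · refine (hCle' j u Du D2u ut hW j t σ S hσ hσS).trans ?_
    rw [traceBound, mul_assoc, mul_add (ENNReal.ofReal _), ← mul_assoc (ENNReal.ofReal _),
      ← mul_assoc (ENNReal.ofReal _), ← ENNReal.ofReal_mul (by positivity),
      ← ENNReal.ofReal_mul (by positivity)]
    refine mul_le_mul_right (add_le_add (mul_le_mul_left (ENNReal.ofReal_le_ofReal ?_) _)
      (mul_le_mul_left (ENNReal.ofReal_le_ofReal ?_) _)) _
    · exact le_of_eq (by ring_nf)
    · rw [show -(1 + a) = -(a / 2) + -(1 + a / 2) by ring, Real.rpow_add hS]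
      gcongr ?_ * _
      exact Real.rpow_le_rpow_of_nonpos hσ hσS (by linarith)

lemma ofReal_rpow_mul_traceBound {κ κ' b S : ℝ} (hS : 0 < S) (h : κ' = κ - b) :
    ENNReal.ofReal (S ^ b) * traceBound d p q κ S u ut D2u =
      traceBound d p q κ' S u ut D2u := by
  rw [traceBound, traceBound, mul_add, ← mul_assoc, ← mul_assoc,
    ← ENNReal.ofReal_mul (by positivity), ← ENNReal.ofReal_mul (by positivity),
    ← Real.rpow_add hS, ← Real.rpow_add hS, show b + (2 - κ) = 2 - κ' by rw [h]; ring,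
    show b + -κ = -κ' by rw [h]; ring]

lemma traceBound_ne_top {κ S : ℝ} (hp : 1 ≤ p) (hq : 1 ≤ q) (hW : MemW12 d p q u Du D2u ut) :
    traceBound d p q κ S u ut D2u ≠ ⊤ :=
  ENNReal.add_ne_top.2 ⟨ENNReal.mul_ne_top ENNReal.ofReal_ne_top (hW.topNorm_ne_top hp hq),
    ENNReal.mul_ne_top ENNReal.ofReal_ne_top hW.1.2⟩

lemma exists_trace_of_memW12 (hp : 1 < p) (hq : 1 < q) (hpr : p ≤ r)
    (ha : a = (d : ℝ) / p + 2 / q - d / r) (ha0 : 0 ≤ a) (ha2 : a < 2) (hθ : IsTest θ)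
    (hW : MemW12 d p q u Du D2u ut) (t : ℝ) :
    ∃ v : Spc d → ℝ, Measurable v ∧
      Tendsto (fun s => lpE volume r (fun x : Spc d => ‖mollify d θ s u (t, x) - v x‖ₑ))
        (𝓝[>] 0) (𝓝 0) := by
  obtain ⟨C, hC, hCle⟩ := exists_lpE_gen_le hp hq hpr ha ha0 ha2 hθ
  refine exists_trace (by linarith) hθ (hW.1.locallyIntegrable hp hq) t one_pos
    (fun σ hσ => hCle u Du D2u ut hW t σ 1 hσ.1 hσ.2) ?_
  rw [lintegral_mul_const _ (by fun_prop), lintegral_const_mul _ (by fun_prop),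
    lintegral_Ioc_rpow (by linarith) one_pos]
  exact ENNReal.mul_ne_top (ENNReal.mul_ne_top hC ENNReal.ofReal_ne_top)
    (traceBound_ne_top hp.le hq.le hW)

lemma exists_trace_deriv_of_memW12 (hp : 1 < p) (hq : 1 < q) (hpr : p ≤ r)
    (ha : a = (d : ℝ) / p + 2 / q - d / r) (ha1 : a < 1) (hθ : IsTest θ)
    (hW : MemW12 d p q u Du D2u ut) (i : Fin d) (t : ℝ) :
    ∃ v : Spc d → ℝ, Measurable v ∧
      Tendsto (fun s => lpE volume r (fun x : Spc d => ‖mollify d θ s (Du i) (t, x) - v x‖ₑ))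
        (𝓝[>] 0) (𝓝 0) := by
  obtain ⟨C, hC, hCle⟩ := exists_lpE_gen_deriv_le hp hq hpr ha hθ
  refine exists_trace (by linarith) hθ ((hW.2.2.2.2.1 i).locallyIntegrable hp hq) t one_pos
    (fun σ hσ => hCle u Du D2u ut hW i t σ hσ.1) ?_
  rw [lintegral_mul_const _ (by fun_prop), lintegral_const_mul _ (by fun_prop),
    lintegral_Ioc_rpow ha1 one_pos]
  exact ENNReal.mul_ne_top (ENNReal.mul_ne_top hC ENNReal.ofReal_ne_top)
    (hW.topNorm_ne_top hp.le hq.le)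

lemma exists_lpE_mollify_le_traceBound (hp : 1 < p) (hq : 1 < q) (hpr : p ≤ r)
    (ha : a = (d : ℝ) / p + 2 / q - d / r) (ha0 : 0 ≤ a) (ha2 : a < 2) (hθ : IsTest θ) :
    ∃ C : ℝ≥0∞, C ≠ ⊤ ∧ ∀ (u : SpT d → ℝ) (Du : Fin d → SpT d → ℝ)
      (D2u : Fin d → Fin d → SpT d → ℝ) (ut : SpT d → ℝ), MemW12 d p q u Du D2u ut →
      ∀ (t s S : ℝ), 0 < s → s ≤ S →
        lpE volume r (fun x : Spc d => ‖mollify d θ s u (t, x)‖ₑ) ≤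
          C * traceBound d p q a S u ut D2u := by
  obtain ⟨C, hC, hCle⟩ := exists_lpE_gen_le hp hq hpr ha ha0 ha2 hθ
  obtain ⟨C', hC', hCle'⟩ := hθ.lpE_mollify_le hp hq hpr
  rw [← ha] at hCle'
  set k := ENNReal.ofReal ((1 - a / 2)⁻¹)
  refine ⟨C' + C * k, ENNReal.add_ne_top.2 ⟨hC', ENNReal.mul_ne_top hC ENNReal.ofReal_ne_top⟩,
    fun u Du D2u ut hW t s S hs hsS => ?_⟩
  have hS : 0 < S := hs.trans_le hsS
  refine (lpE_mollify_le_add (by linarith) hθ (hW.1.locallyIntegrable hp hq) t hs hsS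
    fun σ hσ => hCle u Du D2u ut hW t σ S (hs.trans hσ.1) hσ.2).trans ?_
  rw [add_mul]
  refine add_le_add ?_ ?_
  · refine (hCle' u hW.1.1 t S hS).trans ?_
    rw [mul_assoc, traceBound]
    gcongr
    exact le_add_self
  · refine (lintegral_mono_set (Ioc_subset_Ioc_left hs.le)).trans_eq ?_
    rw [lintegral_mul_const _ (by fun_prop), lintegral_const_mul _ (by fun_prop),
      lintegral_Ioc_rpow (by linarith) hS, div_eq_inv_mul,
      ENNReal.ofReal_mul (by rw [inv_nonneg]; linarith), ← mul_assoc, mul_assoc (C * _),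
      ofReal_rpow_mul_traceBound (κ' := a) hS (by ring)]

lemma exists_lpE_mollify_deriv_le_traceBound (hp : 1 < p) (hq : 1 < q) (hpr : p ≤ r)
    (ha : a = (d : ℝ) / p + 2 / q - d / r) (ha1 : a < 1) (hθ : IsTest θ) :
    ∃ C : ℝ≥0∞, C ≠ ⊤ ∧ ∀ (u : SpT d → ℝ) (Du : Fin d → SpT d → ℝ)
      (D2u : Fin d → Fin d → SpT d → ℝ) (ut : SpT d → ℝ), MemW12 d p q u Du D2u ut →
      ∀ (i : Fin d) (t s S : ℝ), 0 < s → s ≤ S →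
        lpE volume r (fun x : Spc d => ‖mollify d θ s (Du i) (t, x)‖ₑ) ≤
          C * traceBound d p q (1 + a) S u ut D2u := by
  obtain ⟨C, hC, hCle⟩ := exists_lpE_deriv_le (b := 0) hp hq hpr ha le_rfl (by linarith) hθ
  refine ⟨C, hC, fun u Du D2u ut hW i t s S hs hsS =>
    (hCle u Du D2u ut hW i t s S hs hsS).trans_eq ?_⟩
  rw [traceBound, neg_zero, Real.rpow_zero, one_mul, show 1 + 0 - a = 2 - (1 + a) by ring]

end TraceBound

lemma lpE_le_of_tendsto {α : Type*} [MeasurableSpace α] {μ : Measure α} {r : ℝ} (hr : 0 < r)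
    {F : ℕ → α → ℝ≥0∞} {f : α → ℝ≥0∞} {Q : ℝ≥0∞} (hF : ∀ n, Measurable (F n))
    (hlim : ∀ x, Tendsto (fun n => F n x) atTop (𝓝 (f x))) (hQ : ∀ n, lpE μ r (F n) ≤ Q) :
    lpE μ r f ≤ Q := by
  refine lpE_le_of_rpow_le hr ?_
  calc ∫⁻ x, f x ^ r ∂μ = ∫⁻ x, liminf (fun n => F n x ^ r) atTop ∂μ :=
        lintegral_congr fun x =>
          ((ENNReal.continuous_rpow_const.tendsto _).comp (hlim x)).liminf_eq.symm
    _ ≤ liminf (fun n => ∫⁻ x, F n x ^ r ∂μ) atTop :=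
        lintegral_liminf_le fun n => (hF n).pow_const r
    _ ≤ Q ^ r := by
        refine (liminf_le_liminf (v := fun _ => Q ^ r) (Eventually.of_forall fun n => ?_)).trans_eq
          tendsto_const_nhds.liminf_eq
        rw [← lpE_rpow hr]
        exact ENNReal.rpow_le_rpow (hQ n) hr.le

/-- Nonnegative smooth compactly supported kernels of unit mass. -/
structure IsKernel {d : ℕ} (η : SpT d → ℝ) : Prop where
  isTest : IsTest η
  nonneg : ∀ w, 0 ≤ η w
  integral_eq_one : ∫ w, η w = 1

section KernelIndependence

variable {d : ℕ} {η θ ζ f : SpT d → ℝ} {r : ℝ}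

lemma IsMollifier.isKernel (hζ : IsMollifier d ζ) : IsKernel ζ := by
  refine ⟨⟨hζ.1, ?_⟩, hζ.2.1, hζ.2.2.1⟩
  exact HasCompactSupport.of_support_subset_isCompact
    (isCompact_Icc.prod (isCompact_closedBall (0 : Spc d) 1))
    (hζ.2.2.2.trans (prod_mono Ico_subset_Icc_self ball_subset_closedBall))

lemma exists_isKernel (d : ℕ) : ∃ θ : SpT d → ℝ, IsKernel θ := by
  let φ : ContDiffBump (0 : SpT d) := default
  exact ⟨φ.normed volume, ⟨φ.contDiff_normed, φ.hasCompactSupport_normed⟩, φ.nonneg_normed,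
    φ.integral_normed⟩

lemma integral_dil (hη : IsTest η) {s : ℝ} (hs : 0 < s) : ∫ w, dil η s w = ∫ w, η w := by
  have hi : Integrable η volume := hη.1.continuous.integrable_of_hasCompactSupport hη.2
  have hid : Integrable (dil η s) volume :=
    (hη.dil hs).1.continuous.integrable_of_hasCompactSupport (hη.dil hs).2
  rw [Measure.volume_eq_prod] at hi hid ⊢
  rw [integral_prod _ hi, integral_prod _ hid]
  unfold dil
  simp_rw [integral_const_mul]
  have h1 : ∀ t : ℝ, ∫ x : Spc d, η (t / s ^ 2, s⁻¹ • x) =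
      s ^ d * ∫ x : Spc d, η (t / s ^ 2, x) := by
    intro t
    rw [Measure.integral_comp_smul volume (fun x => η (t / s ^ 2, x))]
    simp [abs_of_pos hs]
  simp_rw [h1, integral_const_mul]
  rw [Measure.integral_comp_div (fun t => ∫ x : Spc d, η (t, x)), smul_eq_mul, ← mul_assoc,
    ← mul_assoc, abs_of_pos (by positivity)]
  have h2 : s ^ (-(d : ℝ) - 2) * s ^ d * s ^ 2 = 1 := by
    rw [← Real.rpow_natCast s d, ← Real.rpow_natCast s 2, ← Real.rpow_add hs, ← Real.rpow_add hs]
    rw [show -(d : ℝ) - 2 + d + (2 : ℕ) = 0 by push_cast; ring, Real.rpow_zero]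
  rw [h2, one_mul]

lemma IsKernel.dil_nonneg (hη : IsKernel η) {s : ℝ} (hs : 0 < s) (w : SpT d) : 0 ≤ dil η s w :=
  mul_nonneg (Real.rpow_nonneg hs.le _) (hη.nonneg _)

lemma IsKernel.lintegral_dil (hη : IsKernel η) {s : ℝ} (hs : 0 < s) :
    ∫⁻ w, ‖dil η s w‖ₑ = 1 := by
  have hd := hη.isTest.dil hs
  simp_rw [fun w => Real.enorm_eq_ofReal (hη.dil_nonneg hs w)]
  rw [← ofReal_integral_eq_lintegral_ofReal
    (hd.1.continuous.integrable_of_hasCompactSupport hd.2)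
    (Eventually.of_forall fun w => hη.dil_nonneg hs w), integral_dil hη.isTest hs,
    hη.integral_eq_one, ENNReal.ofReal_one]

lemma mollify_mollify_eq (hη : IsTest η) (hθ : IsTest θ) (hf : LocallyIntegrable f volume)
    {s σ : ℝ} (hs : 0 < s) (hσ : 0 < σ) :
    mollify d η s (mollify d θ σ f) =
      convolution (convolution (dil η s) (dil θ σ) (ContinuousLinearMap.mul ℝ ℝ) volume) f
        (ContinuousLinearMap.mul ℝ ℝ) volume := by
  have hη' := hη.dil hs
  have hθ' := hθ.dil hσ
  have hfn : LocallyIntegrable (fun x => ‖f x‖) volume := fun x => (hf x).norm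
  ext z
  rw [← convolution_eq_mollify, ← convolution_eq_mollify]
  refine (convolution_assoc _ _ _ _ (fun x y z => by simp [mul_assoc])
    hη'.1.continuous.aestronglyMeasurable hθ'.1.continuous.aestronglyMeasurable
    hf.aestronglyMeasurable ?_ ?_ ?_).symm
  · exact Eventually.of_forall fun y => hη'.2.convolutionExists_left _ hη'.1.continuous
      hθ'.1.continuous.locallyIntegrable y
  · exact Eventually.of_forall fun y => hθ'.2.norm.convolutionExists_left _ hθ'.1.continuous.norm
      hfn y
  · exact hη'.2.norm.convolutionExists_left _ hη'.1.continuous.norm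
      (hθ'.2.norm.continuous_convolution_left _ hθ'.1.continuous.norm
        hfn).locallyIntegrable z

lemma mollify_comm (hη : IsTest η) (hθ : IsTest θ) (hf : LocallyIntegrable f volume)
    {s σ : ℝ} (hs : 0 < s) (hσ : 0 < σ) :
    mollify d η s (mollify d θ σ f) = mollify d θ σ (mollify d η s f) := by
  rw [mollify_mollify_eq hη hθ hf hs hσ, mollify_mollify_eq hθ hη hf hσ hs,
    ← convolution_flip (f := dil θ σ), ContinuousLinearMap.flip_mul]

lemma continuous_mollify (hη : IsTest η) (hf : LocallyIntegrable f volume) {s : ℝ} (hs : 0 < s) :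
    Continuous (mollify d η s f) :=
  (hη.dil hs).2.continuous_convolution_left (ContinuousLinearMap.mul ℝ ℝ)
    (hη.dil hs).1.continuous hf

lemma IsKernel.lpE_mollify_le (hr : 1 ≤ r) (hη : IsKernel η) (hf : Measurable f) {Q : ℝ≥0∞}
    (hQ : ∀ t, lpE volume r (fun x : Spc d => ‖f (t, x)‖ₑ) ≤ Q) {s : ℝ} (hs : 0 < s) (t : ℝ) :
    lpE volume r (fun x : Spc d => ‖mollify d η s f (t, x)‖ₑ) ≤ Q := by
  have hdm : Measurable (dil η s) := (hη.isTest.dil hs).1.continuous.measurable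
  calc lpE volume r (fun x : Spc d => ‖mollify d η s f (t, x)‖ₑ)
      ≤ lpE volume r (fun x : Spc d =>
          ∫⁻ w, ‖dil η s w‖ₑ * ‖f (t - w.1, x - w.2)‖ₑ) := by
        refine lpE_mono (by linarith) fun x => ?_
        rw [mollify_eq]
        exact (enorm_integral_le_lintegral_enorm _).trans_eq
          (lintegral_congr fun w => enorm_mul _ _)
    _ ≤ ∫⁻ w, lpE volume r (fun x : Spc d => ‖dil η s w‖ₑ * ‖f (t - w.1, x - w.2)‖ₑ) := by
        refine lpE_lintegral_le hr ?_
        unfold Function.uncurry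
        fun_prop
    _ ≤ ∫⁻ w, ‖dil η s w‖ₑ * Q := by
        refine lintegral_mono fun w => ?_
        rw [lpE_const_mul (by linarith) _ (by fun_prop),
          lpE_sub_right r (fun x : Spc d => ‖f (t - w.1, x)‖ₑ)]
        gcongr
        exact hQ _
    _ = Q := by
        rw [lintegral_mul_const _ hdm.enorm, hη.lintegral_dil hs, one_mul]

lemma IsKernel.tendsto_mollify (hη : IsKernel η) (hf : Continuous f) {σ : ℕ → ℝ}
    (hσ0 : ∀ n, 0 < σ n) (hσ : Tendsto σ atTop (𝓝 0)) (z : SpT d) :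
    Tendsto (fun n => mollify d η (σ n) f z) atTop (𝓝 (f z)) := by
  obtain ⟨R, M, hR1, -, -, hR⟩ := hη.isTest.exists_bound
  refine convolution_tendsto_right (μ := volume) (φ := fun n => dil η (σ n)) (g := fun _ => f)
    (k := fun _ => z) (Eventually.of_forall fun n => hη.dil_nonneg (hσ0 n))
    (Eventually.of_forall fun n => by
      rw [integral_dil hη.isTest (hσ0 n), hη.integral_eq_one]) ?_
    (Eventually.of_forall fun n => hf.aestronglyMeasurable)
    ((hf.tendsto z).comp tendsto_snd) tendsto_const_nhds
  refine tendsto_smallSets_iff.2 fun t ht => ?_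
  obtain ⟨ε, hε, hεt⟩ := Metric.nhds_basis_closedBall.mem_iff.1 ht
  have h1 : Tendsto (fun n => σ n ^ 2 * R) atTop (𝓝 0) := by
    simpa using (hσ.pow 2).mul_const R
  have h2 : Tendsto (fun n => σ n * R) atTop (𝓝 0) := by
    simpa using hσ.mul_const R
  filter_upwards [h1.eventually_le_const hε, h2.eventually_le_const hε] with n hn1 hn2
  intro w hw
  refine hεt ?_
  obtain ⟨ha, hb⟩ := dil_support (hσ0 n) hR w hw
  rw [mem_closedBall_zero_iff] at hb ⊢
  rw [Prod.norm_def]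
  refine max_le ?_ (hb.trans hn2)
  rw [Real.norm_eq_abs]
  exact (abs_le.2 ha).trans hn1

/-- A bound on the slices of all small-scale mollifications is independent of the kernel. -/
lemma IsKernel.lpE_mollify_le_of_kernel (hr : 1 ≤ r) (hζ : IsKernel ζ) (hθ : IsKernel θ)
    (hf : LocallyIntegrable f volume) {Q : ℝ≥0∞} {S : ℝ} (hS : 0 < S)
    (hQ : ∀ t σ, 0 < σ → σ ≤ S →
      lpE volume r (fun x : Spc d => ‖mollify d θ σ f (t, x)‖ₑ) ≤ Q)
    {s : ℝ} (hs : 0 < s) (t : ℝ) :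
    lpE volume r (fun x : Spc d => ‖mollify d ζ s f (t, x)‖ₑ) ≤ Q := by
  set σ : ℕ → ℝ := fun n => S * (1 / ((n : ℝ) + 1))
  have hσ0 : ∀ n, 0 < σ n := fun n => by positivity
  have hσS : ∀ n, σ n ≤ S := fun n => by
    refine mul_le_of_le_one_right hS.le ?_
    rw [div_le_one (by positivity)]
    linarith [(n.cast_nonneg : (0 : ℝ) ≤ n)]
  have hσ : Tendsto σ atTop (𝓝 0) := by
    rw [← mul_zero S]
    exact tendsto_one_div_add_atTop_nhds_zero_nat.const_mul S
  have hc := continuous_mollify hζ.isTest hf hs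
  refine lpE_le_of_tendsto (by linarith)
    (F := fun n x => ‖mollify d θ (σ n) (mollify d ζ s f) (t, x)‖ₑ)
    (fun n => ((continuous_mollify hθ.isTest hc.locallyIntegrable (hσ0 n)).comp
      (Continuous.prodMk_right t)).measurable.enorm)
    (fun x => (hθ.tendsto_mollify hc hσ0 hσ (t, x)).enorm) fun n => ?_
  rw [mollify_comm hθ.isTest hζ.isTest hf (hσ0 n) hs]
  exact hζ.lpE_mollify_le hr (continuous_mollify hθ.isTest hf (hσ0 n)).measurable
    (fun t => hQ t _ (hσ0 n) (hσS n)) hs t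

/-- The slicewise bound passes to the trace. -/
lemma lpE_trace_le (hr : 1 ≤ r) (hη : IsTest η) (hf : AEStronglyMeasurable f volume) {Q : ℝ≥0∞}
    {t : ℝ} {v : Spc d → ℝ} (hv : Measurable v)
    (hlim : Tendsto (fun s => lpE volume r (fun x : Spc d => ‖mollify d η s f (t, x) - v x‖ₑ))
      (𝓝[>] 0) (𝓝 0))
    (hQ : ∀ s, 0 < s → lpE volume r (fun x : Spc d => ‖mollify d η s f (t, x)‖ₑ) ≤ Q) :
    lpE volume r (fun x => ‖v x‖ₑ) ≤ Q := by
  have h : Tendsto (fun s => lpE volume r (fun x : Spc d =>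
      ‖mollify d η s f (t, x) - v x‖ₑ) + Q) (𝓝[>] 0) (𝓝 (0 + Q)) := hlim.add_const Q
  rw [zero_add] at h
  refine ge_of_tendsto h ?_
  filter_upwards [self_mem_nhdsWithin] with s hs
  have hm := measurable_mollify_slice hη hf s t
  have hmv : Measurable fun x : Spc d => mollify d η s f (t, x) - v x := hm.sub hv
  calc lpE volume r (fun x => ‖v x‖ₑ)
      ≤ lpE volume r (fun x : Spc d =>
          ‖mollify d η s f (t, x) - v x‖ₑ + ‖mollify d η s f (t, x)‖ₑ) := by
        refine lpE_mono (by linarith) fun x => ?_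
        rw [← enorm_neg (mollify d η s f (t, x) - v x)]
        refine le_trans (le_of_eq ?_) (enorm_add_le _ _)
        congr 1; ring
    _ ≤ _ := (lpE_add_le hr hmv.enorm.aemeasurable hm.enorm.aemeasurable).trans
        (by gcongr; exact hQ s hs)

end KernelIndependence

section Trace

variable {d : ℕ} {p q r : ℝ} {u ut : SpT d → ℝ} {Du : Fin d → SpT d → ℝ}
  {D2u : Fin d → Fin d → SpT d → ℝ}

lemma mul_traceBound_rpow (N : ℝ≥0∞) {κ ε : ℝ} (hκ : κ < 2) (hε : 0 < ε) :
    N * traceBound d p q κ (ε ^ (1 / (2 - κ))) u ut D2u =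
      N * ENNReal.ofReal ε *
          (lpqNorm d p q ut Set.univ + lpqNorm d p q (hessMag d D2u) Set.univ)
        + N * ENNReal.ofReal (ε ^ (-κ / (2 - κ))) * lpqNorm d p q u Set.univ := by
  have h2 : 2 - κ ≠ 0 := by linarith
  rw [traceBound, topNorm, ← Real.rpow_mul hε.le, ← Real.rpow_mul hε.le, one_div_mul_cancel h2,
    Real.rpow_one, one_div_mul_eq_div]
  ring

lemma lpE_eq_abs (v : Spc d → ℝ) :
    lpE volume r (fun x => ‖v x‖ₑ) = (∫⁻ x : Spc d, ENNReal.ofReal |v x| ^ r) ^ (1 / r) := by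
  simp_rw [Real.enorm_eq_ofReal_abs]
  rfl

lemma tendstoLr_univ_iff {F : ℝ → Spc d → ℝ} {v : Spc d → ℝ} :
    TendstoLr d r Set.univ F v ↔
      Tendsto (fun ε => lpE volume r fun x => ‖F ε x - v x‖ₑ) (𝓝[>] 0) (𝓝 0) := by
  simp_rw [fun ε => lpE_eq_abs (r := r) fun x => F ε x - v x, TendstoLr, Measure.restrict_univ]

lemma lpE_sqrt_sum_sq_le {v : Fin d → Spc d → ℝ} (hr : 1 ≤ r) (hv : ∀ i, Measurable (v i)) :
    (∫⁻ x : Spc d, ENNReal.ofReal (Real.sqrt (∑ i, (v i x) ^ 2)) ^ r) ^ (1 / r) ≤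
      ∑ i, lpE volume r (fun x => ‖v i x‖ₑ) := by
  refine le_trans ?_ (lpE_sum_le Finset.univ hr fun i => (hv i).enorm)
  refine lpE_mono (by linarith) fun x => ?_
  simp_rw [Real.enorm_eq_ofReal_abs]
  rw [← ENNReal.ofReal_sum_of_nonneg fun _ _ => abs_nonneg _]
  refine ENNReal.ofReal_le_ofReal
    (Real.sqrt_le_iff.2 ⟨Finset.sum_nonneg fun _ _ => abs_nonneg _, ?_⟩)
  simpa using Finset.sum_sq_le_sq_sum_of_nonneg (s := Finset.univ)
    (f := fun i => |v i x|) fun _ _ => abs_nonneg _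

end Trace

/-- Lemma 6,17.1, trace estimate in `L_{p,q}`: with
    `κ = γ + d/p + 2/q - d/r < 2`, for `u ∈ W^{1,2}_{p,q}(ℝ^{d+1})` the
    functions `D^γ u^{(ε')}(0,·)` converge in `L_r(ℝ^d)` as `ε' ↓ 0` to a
    trace `D^γ u(0,·)`, and for every `ε > 0`,
    `‖D^γ u(0,·)‖_{L_r} ≤ Nε(‖∂ₜu‖+‖D²u‖)_{L_{p,q}} + Nε^{-κ/(2-κ)}‖u‖_{L_{p,q}}`. -/
theorem statement11 (d : ℕ) (hd : 1 ≤ d) (p q r : ℝ)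
    (hp : 1 < p) (hq : 1 < q) (hr : p ≤ r) (γ : ℕ) (hγ : γ = 0 ∨ γ = 1)
    (κ : ℝ) (hκdef : κ = (γ : ℝ) + (d : ℝ) / p + 2 / q - (d : ℝ) / r) (hκ : κ < 2) :
    ∃ N : ℝ≥0, ∀ ζ : SpT d → ℝ, IsMollifier d ζ →
      ∀ (u : SpT d → ℝ) (Du : Fin d → SpT d → ℝ)
        (D2u : Fin d → Fin d → SpT d → ℝ) (ut : SpT d → ℝ),
        MemW12 d p q u Du D2u ut →
        (γ = 0 → ∃ v : Spc d → ℝ,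
          TendstoLr d r Set.univ (fun ε x => mollify d ζ ε u (0, x)) v ∧
          ∀ ε : ℝ, 0 < ε →
            (∫⁻ x : Spc d, ENNReal.ofReal |v x| ^ r) ^ (1 / r) ≤
              N * ENNReal.ofReal ε *
                  (lpqNorm d p q ut Set.univ + lpqNorm d p q (hessMag d D2u) Set.univ)
                + N * ENNReal.ofReal (ε ^ (-κ / (2 - κ))) * lpqNorm d p q u Set.univ) ∧
        (γ = 1 → ∃ v : Fin d → Spc d → ℝ,
          (∀ i, TendstoLr d r Set.univ
            (fun ε x => fderiv ℝ (mollify d ζ ε u) (0, x) (dirS d i)) (v i)) ∧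
          ∀ ε : ℝ, 0 < ε →
            (∫⁻ x : Spc d,
                ENNReal.ofReal (Real.sqrt (∑ i, (v i x) ^ 2)) ^ r) ^ (1 / r) ≤
              N * ENNReal.ofReal ε *
                  (lpqNorm d p q ut Set.univ + lpqNorm d p q (hessMag d D2u) Set.univ)
                + N * ENNReal.ofReal (ε ^ (-κ / (2 - κ))) * lpqNorm d p q u Set.univ) := by
  have hr1 : 1 ≤ r := by linarith
  set a := (d : ℝ) / p + 2 / q - d / r with ha
  have ha0 : 0 ≤ a := by
    have h1 : (d : ℝ) / r ≤ d / p := div_le_div_of_nonneg_left (by positivity) (by linarith) hr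
    have h2 : 0 ≤ 2 / q := by positivity
    linarith
  obtain ⟨θ, hθ⟩ := exists_isKernel d
  rcases hγ with rfl | rfl
  · have hκa : κ = a := by rw [hκdef, ha]; push_cast; ring
    rw [← hκa] at ha ha0
    obtain ⟨C, hC, hCle⟩ := exists_lpE_mollify_le_traceBound hp hq hr ha ha0 hκ hθ.isTest
    refine ⟨C.toNNReal, fun ζ hζ u Du D2u ut hW => ⟨fun _ => ?_, by simp⟩⟩
    have hf := hW.1.locallyIntegrable hp hq
    have hk := hζ.isKernel
    obtain ⟨v, hv, hlim⟩ := exists_trace_of_memW12 hp hq hr ha ha0 hκ hk.isTest hW 0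
    refine ⟨v, tendstoLr_univ_iff.2 hlim, fun ε hε => ?_⟩
    have hS : 0 < ε ^ (1 / (2 - κ)) := by positivity
    rw [← mul_traceBound_rpow _ hκ hε, ENNReal.coe_toNNReal hC, ← lpE_eq_abs]
    exact lpE_trace_le hr1 hk.isTest hf.aestronglyMeasurable hv hlim fun s hs =>
      hk.lpE_mollify_le_of_kernel hr1 hθ hf hS
        (fun t σ hσ hσS => hCle u Du D2u ut hW t σ _ hσ hσS) hs 0
  · have hκa : κ = 1 + a := by rw [hκdef, ha]; push_cast; ring
    have ha1 : a < 1 := by linarith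
    obtain ⟨C, hC, hCle⟩ := exists_lpE_mollify_deriv_le_traceBound hp hq hr ha ha1 hθ.isTest
    rw [← hκa] at hCle
    have hdC : (d : ℝ≥0∞) * C ≠ ⊤ := ENNReal.mul_ne_top (ENNReal.natCast_ne_top d) hC
    refine ⟨((d : ℝ≥0∞) * C).toNNReal, fun ζ hζ u Du D2u ut hW => ⟨by simp, fun _ => ?_⟩⟩
    have hf := fun i => (hW.2.2.2.2.1 i).locallyIntegrable hp hq
    have hk := hζ.isKernel
    choose v hv hlim using fun i =>
      exists_trace_deriv_of_memW12 hp hq hr ha ha1 hk.isTest hW i 0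
    refine ⟨v, fun i => tendstoLr_univ_iff.2 ((hlim i).congr' ?_), fun ε hε => ?_⟩
    · filter_upwards [self_mem_nhdsWithin] with s hs
      have hs' : 0 < s := hs
      congr 1
      ext x
      rw [fderiv_mollify_apply hk.isTest (hW.1.locallyIntegrable hp hq) hs' _ (dirS_scale d i s),
        (hW.2.1 i).mollify_eq hk.isTest hs' (dirS_scale d i s)]
    · have hS : 0 < ε ^ (1 / (2 - κ)) := by positivity
      rw [← mul_traceBound_rpow _ hκ hε, ENNReal.coe_toNNReal hdC]
      refine (lpE_sqrt_sum_sq_le hr1 hv).trans ?_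
      calc ∑ i, lpE volume r (fun x => ‖v i x‖ₑ)
          ≤ ∑ _i : Fin d, C * traceBound d p q κ (ε ^ (1 / (2 - κ))) u ut D2u :=
            Finset.sum_le_sum fun i _ =>
              lpE_trace_le hr1 hk.isTest (hf i).aestronglyMeasurable (hv i) (hlim i) fun s hs =>
                hk.lpE_mollify_le_of_kernel hr1 hθ (hf i) hS
                  (fun t σ hσ hσS => hCle u Du D2u ut hW i t σ _ hσ hσS) hs 0
        _ = _ := by simp [mul_assoc]
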